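/- arXiv:0903.5125 — 4 statements merged into one kernel-verified Lean document; each statement's English description precedes it below -/
import Mathlib

section
/- For any α > 0 there exists a zero-free function f in the Korenblum class A^{-∞} such that f^{-1} is also in A^{-∞} and H_λ(D_+(f)) = ∞ for the gauge function λ(t) = t·|log t|^α. -/
open Filter MeasureTheory

noncomputable section

/-- Hausdorff measure on `ℝ` with gauge function `lam`:
`H_lam(C) = lim_{ε→0} inf {Σ_s lam(|J_s|) : C ⊆ ⋃_s J_s, |J_s| < ε}`. -/
def hausdorffGauge (lam : ℝ → ℝ) : Measure ℝ :=
  Measure.mkMetric fun d => ENNReal.ofReal (lam d.toReal)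

/-- The Korenblum class `A^{-∞}`: `f` analytic on the unit disc with
`|f(z)| ≤ C (1-|z|)^{-k}` for some constants `C, k > 0`. -/
def Korenblum (f : ℂ → ℂ) : Prop :=
  DifferentiableOn ℂ f (Metric.ball 0 1) ∧
    ∃ C k : ℝ, 0 < C ∧ 0 < k ∧ ∀ z ∈ Metric.ball (0:ℂ) 1, ‖f z‖ ≤ C / (1 - ‖z‖) ^ k

/-- `D_+(f)`: the set of `θ ∈ [0, 2π)` such that
`liminf_{r→1⁻} log|f(re^{iθ})| / |log(1-r)| > 0`. -/
def Dplus (f : ℂ → ℂ) : Set ℝ :=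
  {θ | θ ∈ Set.Ico 0 (2 * Real.pi) ∧
    ∃ c : ℝ, 0 < c ∧ ∀ᶠ r : ℝ in nhdsWithin 1 (Set.Iio 1),
      c ≤ Real.log ‖f ((r : ℂ) * Complex.exp (Complex.I * (θ : ℂ)))‖ / |Real.log (1 - r)|}

open scoped ENNReal

theorem sum_pow_two_pow_le {x : ℝ} (hx0 : 0 ≤ x) (hx1 : x < 1) (m : ℕ) :
    ∑ i ∈ Finset.range m, x ^ 2 ^ (i + 1) ≤ 2 * -Real.log (1 - x) := by
  have hstep : ∑ i ∈ Finset.range m, x ^ 2 ^ (i + 1) ≤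
      2 * ∑ j ∈ Finset.range (2 ^ m), x ^ (j + 1) / ((j : ℝ) + 1) := by
    induction m with
    | zero => simpa using hx0
    | succ m ih =>
      rw [Finset.sum_range_succ, show 2 ^ (m + 1) = 2 ^ m + 2 ^ m by ring, Finset.sum_range_add,
        mul_add, ← show 2 ^ (m + 1) = 2 ^ m + 2 ^ m by ring]
      refine add_le_add ih ?_
      have hle : ∀ j ∈ Finset.range (2 ^ m), x ^ 2 ^ (m + 1) / (2 ^ (m + 1) : ℝ) ≤
          x ^ (2 ^ m + j + 1) / (((2 ^ m + j : ℕ) : ℝ) + 1) := by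
        intro j hj
        have hj' : 2 ^ m + j + 1 ≤ 2 ^ (m + 1) := by
          have := Finset.mem_range.1 hj
          rw [pow_succ]; omega
        have hj'' : ((2 ^ m + j : ℕ) : ℝ) + 1 ≤ 2 ^ (m + 1) := by exact_mod_cast hj'
        exact div_le_div₀ (by positivity) (pow_le_pow_of_le_one hx0 hx1.le hj')
          (by positivity) hj''
      have := Finset.card_nsmul_le_sum _ _ _ hle
      rw [Finset.card_range, nsmul_eq_mul] at this
      have h2 : ((2 ^ m : ℕ) : ℝ) * (x ^ 2 ^ (m + 1) / (2 ^ (m + 1) : ℝ)) =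
          x ^ 2 ^ (m + 1) / 2 := by
        push_cast
        rw [pow_succ (2 : ℝ) m]
        field_simp
      linarith
  have hs := Real.hasSum_pow_div_log_of_abs_lt_one (x := x) (by rw [abs_of_nonneg hx0]; exact hx1)
  have := sum_le_hasSum (Finset.range (2 ^ m)) (fun j _ => by positivity) hs
  linarith

theorem sum_lacunary_le {A : ℕ} (hA : 2 ≤ A) {x : ℝ} (hx0 : 0 ≤ x) (hx1 : x < 1) (K : ℕ) :
    ∑ k ∈ Finset.range K, (A : ℝ) ^ k * x ^ 2 ^ A ^ k ≤ 4 * -Real.log (1 - x) := by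
  have hstep : ∀ K : ℕ, ∑ k ∈ Finset.range (K + 1), (A : ℝ) ^ k * x ^ 2 ^ A ^ k ≤
      2 * ∑ i ∈ Finset.range (A ^ K), x ^ 2 ^ (i + 1) := by
    intro K
    induction K with
    | zero => simp; nlinarith [sq_nonneg x]
    | succ K ih =>
      rw [Finset.sum_range_succ]
      have hdouble : 2 * A ^ K ≤ A ^ (K + 1) := by
        rw [pow_succ, mul_comm]; exact Nat.mul_le_mul_left _ hA
      obtain ⟨L, hL⟩ := Nat.exists_eq_add_of_le (show A ^ K ≤ A ^ (K + 1) by omega)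
      have hLA : A ^ (K + 1) ≤ 2 * L := by omega
      have hLA' : (A : ℝ) ^ (K + 1) ≤ 2 * L := by exact_mod_cast hLA
      have hle : ∀ i ∈ Finset.range L, x ^ 2 ^ A ^ (K + 1) ≤ x ^ 2 ^ (A ^ K + i + 1) := by
        intro i hi
        have := Finset.mem_range.1 hi
        exact pow_le_pow_of_le_one hx0 hx1.le (Nat.pow_le_pow_right two_pos (by omega))
      have := Finset.card_nsmul_le_sum _ _ _ hle
      rw [Finset.card_range, nsmul_eq_mul] at this
      have h0 : 0 ≤ x ^ 2 ^ A ^ (K + 1) := by positivity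
      have h1 := mul_le_mul_of_nonneg_right hLA' h0
      have h2 : ∑ i ∈ Finset.range (A ^ (K + 1)), x ^ 2 ^ (i + 1) =
          ∑ i ∈ Finset.range (A ^ K), x ^ 2 ^ (i + 1) +
            ∑ i ∈ Finset.range L, x ^ 2 ^ (A ^ K + i + 1) := by
        rw [hL, Finset.sum_range_add]
      rw [h2]
      linarith
  have hmono : ∑ k ∈ Finset.range K, (A : ℝ) ^ k * x ^ 2 ^ A ^ k ≤
      ∑ k ∈ Finset.range (K + 1), (A : ℝ) ^ k * x ^ 2 ^ A ^ k := by
    rw [Finset.sum_range_succ]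
    have : 0 ≤ (A : ℝ) ^ K * x ^ 2 ^ A ^ K := by positivity
    linarith
  have := hstep K
  have := sum_pow_two_pow_le hx0 hx1 (A ^ K)
  linarith

/-- The lacunary series `∑ A ^ k z ^ (2 ^ A ^ k)`. -/
def lacunary (A : ℕ) (z : ℂ) : ℂ := ∑' k : ℕ, (A : ℂ) ^ k * z ^ 2 ^ A ^ k

theorem summable_lacunary_norm {A : ℕ} (hA : 2 ≤ A) {x : ℝ} (hx0 : 0 ≤ x) (hx1 : x < 1) :
    Summable fun k : ℕ => (A : ℝ) ^ k * x ^ 2 ^ A ^ k :=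
  summable_of_sum_range_le (fun k => by positivity) (sum_lacunary_le hA hx0 hx1)

theorem norm_lacunary_term (A k : ℕ) (z : ℂ) :
    ‖(A : ℂ) ^ k * z ^ 2 ^ A ^ k‖ = (A : ℝ) ^ k * ‖z‖ ^ 2 ^ A ^ k := by
  simp

theorem summable_lacunary {A : ℕ} (hA : 2 ≤ A) {z : ℂ} (hz : ‖z‖ < 1) :
    Summable fun k : ℕ => (A : ℂ) ^ k * z ^ 2 ^ A ^ k := by
  refine Summable.of_norm ?_
  simpa only [norm_lacunary_term] using summable_lacunary_norm hA (norm_nonneg z) hz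

theorem norm_lacunary_le {A : ℕ} (hA : 2 ≤ A) {z : ℂ} (hz : ‖z‖ < 1) :
    ‖lacunary A z‖ ≤ 4 * -Real.log (1 - ‖z‖) := by
  refine (norm_tsum_le_tsum_norm ?_).trans ?_
  · simpa only [norm_lacunary_term] using summable_lacunary_norm hA (norm_nonneg z) hz
  · simp only [norm_lacunary_term]
    exact Real.tsum_le_of_sum_range_le (fun k => by positivity)
      (sum_lacunary_le hA (norm_nonneg z) hz)

theorem differentiableOn_lacunary {A : ℕ} (hA : 2 ≤ A) :
    DifferentiableOn ℂ (lacunary A) (Metric.ball 0 1) := by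
  intro z hz
  rw [mem_ball_zero_iff] at hz
  obtain ⟨x, hzx, hx1⟩ := exists_between hz
  have hx0 : 0 ≤ x := (norm_nonneg z).trans hzx.le
  have hd : DifferentiableOn ℂ (lacunary A) (Metric.ball 0 x) := by
    refine Complex.differentiableOn_tsum_of_summable_norm (summable_lacunary_norm hA hx0 hx1)
      (fun k => by fun_prop) Metric.isOpen_ball fun k w hw => ?_
    rw [mem_ball_zero_iff] at hw
    rw [norm_lacunary_term]
    gcongr
  exact (hd.differentiableAt (Metric.isOpen_ball.mem_nhds (by simpa using hzx))).differentiableWithinAt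

theorem norm_exp_le_of_norm_le {w : ℂ} {x : ℝ} (hx1 : x < 1)
    (hw : ‖w‖ ≤ 4 * -Real.log (1 - x)) : ‖Complex.exp w‖ ≤ 1 / (1 - x) ^ (4 : ℝ) := by
  have h0 : 0 < 1 - x := by linarith
  rw [Complex.norm_exp, one_div, ← Real.rpow_neg h0.le, Real.rpow_def_of_pos h0, Real.exp_le_exp]
  have := (Complex.re_le_norm w).trans hw
  linarith

theorem le_re_lacunary {A : ℕ} (hA : 2 ≤ A) {r θ : ℝ} (hr0 : 0 ≤ r) (hr1 : r < 1)
    (hθ : ∀ k : ℕ, 1 / 2 ≤ Real.cos (2 ^ A ^ k * θ)) (k : ℕ) :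
    (A : ℝ) ^ k * r ^ 2 ^ A ^ k / 2 ≤
      (lacunary A ((r : ℂ) * Complex.exp (Complex.I * (θ : ℂ)))).re := by
  have hnorm : ‖(r : ℂ) * Complex.exp (Complex.I * (θ : ℂ))‖ < 1 := by
    rw [mul_comm Complex.I, norm_mul, Complex.norm_exp_ofReal_mul_I, mul_one]
    simpa [abs_of_nonneg hr0] using hr1
  have hsum := Complex.hasSum_re (summable_lacunary hA hnorm).hasSum
  have hterm : ∀ j : ℕ, ((A : ℂ) ^ j * ((r : ℂ) * Complex.exp (Complex.I * (θ : ℂ))) ^ 2 ^ A ^ j).re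
      = (A : ℝ) ^ j * r ^ 2 ^ A ^ j * Real.cos (2 ^ A ^ j * θ) := by
    intro j
    rw [mul_pow, ← Complex.exp_nat_mul]
    have : (((2 ^ A ^ j : ℕ) : ℂ) * (Complex.I * (θ : ℂ))) =
        ((2 ^ A ^ j * θ : ℝ) : ℂ) * Complex.I := by push_cast; ring
    rw [this, ← mul_assoc]
    have h2 : (A : ℂ) ^ j * (r : ℂ) ^ 2 ^ A ^ j = (((A : ℝ) ^ j * r ^ 2 ^ A ^ j : ℝ) : ℂ) := by
      push_cast; ring
    rw [h2, Complex.re_ofReal_mul, Complex.exp_ofReal_mul_I_re]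
  have hpos : ∀ j : ℕ, 0 ≤ (A : ℝ) ^ j * r ^ 2 ^ A ^ j := fun j => by positivity
  simp only [hterm] at hsum
  have h1 := le_hasSum hsum k fun j _ => mul_nonneg (hpos j) (by linarith [hθ j])
  refine le_trans ?_ h1
  nlinarith [hpos k, hθ k]

theorem log_le_re_lacunary {A : ℕ} (hA : 2 ≤ A) {r θ : ℝ} (hr : 3 / 4 ≤ r) (hr1 : r < 1)
    (hθ : ∀ k : ℕ, 1 / 2 ≤ Real.cos (2 ^ A ^ k * θ)) :
    -Real.log (1 - r) / (8 * A) ≤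
      (lacunary A ((r : ℂ) * Complex.exp (Complex.I * (θ : ℂ)))).re := by
  have h0 : 0 < 1 - r := by linarith
  have hA0 : (0 : ℝ) < A := by positivity
  have hex : ∃ k : ℕ, 1 < 2 * 2 ^ A ^ k * (1 - r) := by
    obtain ⟨k, hk⟩ := pow_unbounded_of_one_lt (1 / (1 - r)) (one_lt_two (α := ℝ))
    refine ⟨k, ?_⟩
    rw [div_lt_iff₀ h0] at hk
    have : (2 : ℝ) ^ k ≤ 2 ^ A ^ k :=
      pow_le_pow_right₀ one_le_two (Nat.lt_pow_self (by omega)).le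
    nlinarith
  classical
  have hfind := Nat.find_spec hex
  have hne : Nat.find hex ≠ 0 := by
    intro h
    rw [h] at hfind
    norm_num at hfind
    linarith
  obtain ⟨k, hk⟩ := Nat.exists_eq_add_one_of_ne_zero hne
  have hmin := Nat.find_min hex (m := k) (by omega)
  rw [hk] at hfind
  push Not at hmin
  refine le_trans ?_ (le_re_lacunary hA (by linarith) hr1 hθ k)
  have hbern : 1 / 2 ≤ r ^ 2 ^ A ^ k := by
    have := one_add_mul_le_pow (a := r - 1) (by linarith) (2 ^ A ^ k)
    push_cast at this
    rw [add_sub_cancel] at this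
    linarith
  have hlog : -Real.log (1 - r) ≤ 2 * A ^ (k + 1) := by
    have h1 := Real.log_le_log one_pos hfind.le
    rw [Real.log_mul (by positivity) h0.ne', ← pow_succ', Real.log_pow, Real.log_one] at h1
    have h2 : Real.log 2 ≤ 1 := by linarith [Real.log_two_lt_d9]
    have h3 : (1 : ℝ) ≤ A ^ (k + 1) := one_le_pow₀ (by exact_mod_cast (by omega : 1 ≤ A))
    push_cast at h1
    have h4 : (0 : ℝ) ≤ A ^ (k + 1) + 1 := by positivity
    nlinarith [mul_le_mul_of_nonneg_left h2 h4]
  rw [div_le_iff₀ (by positivity)]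
  have h5 : (0 : ℝ) ≤ A ^ k * A := by positivity
  rw [pow_succ] at hlog
  nlinarith [mul_le_mul_of_nonneg_left hbern h5]

/-- The integer with binary expansion `a 0, …, a (n - 1)`, most significant digit first. -/
def binaryPrefix (a : ℕ → Fin 2) : ℕ → ℕ
  | 0 => 0
  | n + 1 => 2 * binaryPrefix a n + a n

theorem two_pow_mul_ofDigits (a : ℕ → Fin 2) (n : ℕ) :
    2 ^ n * Real.ofDigits a = binaryPrefix a n + Real.ofDigits fun i => a (i + n) := by
  have hsum : 2 ^ n * ∑ i ∈ Finset.range n, Real.ofDigitsTerm a i = binaryPrefix a n := by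
    induction n with
    | zero => simp [binaryPrefix]
    | succ n ih =>
      rw [Finset.sum_range_succ, mul_add, pow_succ', mul_assoc, ih]
      simp only [Real.ofDigitsTerm, binaryPrefix]
      push_cast
      field_simp
      ring
  rw [Real.ofDigits_eq_sum_add_ofDigits a n, mul_add, hsum]
  push_cast
  rw [mul_inv_cancel_left₀ (by positivity)]

theorem eq_of_binaryPrefix_eq {a b : ℕ → Fin 2} {n : ℕ}
    (h : binaryPrefix a n = binaryPrefix b n) : ∀ j < n, a j = b j := by
  induction n with
  | zero => simp
  | succ n ih =>
    simp only [binaryPrefix] at h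
    have ha := (a n).isLt
    have hb := (b n).isLt
    intro j hj
    rcases Nat.lt_succ_iff_lt_or_eq.1 hj with hj | rfl
    · exact ih (by omega) j hj
    · ext; omega

/-- Replace the digits at the places in `S` by zero. -/
def maskDigits (S : Set ℕ) (a : ℕ → Fin 2) : ℕ → Fin 2 :=
  open Classical in fun j => if j ∈ S then 0 else a j

/-- Law of a sequence of independent fair binary digits. -/
def coinMeasure : Measure (ℕ → Fin 2) :=
  Measure.infinitePi fun _ => (PMF.uniformOfFintype (Fin 2)).toMeasure

instance : IsProbabilityMeasure coinMeasure := by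
  unfold coinMeasure; infer_instance

open Classical in
theorem coinMeasure_prefix_le (S : Set ℕ) (n m : ℕ) :
    coinMeasure {a | binaryPrefix (maskDigits S a) n = m} ≤
      2⁻¹ ^ ((Finset.range n).filter (· ∉ S)).card := by
  by_cases hne : ∃ b, binaryPrefix (maskDigits S b) n = m
  · obtain ⟨b, rfl⟩ := hne
    have hsub : {a | binaryPrefix (maskDigits S a) n = binaryPrefix (maskDigits S b) n} ⊆
        Set.pi ((Finset.range n).filter (· ∉ S) : Finset ℕ) fun j => {b j} := by
      intro a ha j hj
      simp only [Finset.coe_filter, Finset.mem_range, Set.mem_ofPred_eq] at hj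
      simpa [maskDigits, hj.2] using eq_of_binaryPrefix_eq ha j hj.1
    refine (measure_mono hsub).trans ?_
    rw [coinMeasure, Measure.infinitePi_pi _ (fun _ _ => measurableSet_singleton _)]
    simp
  · have : {a | binaryPrefix (maskDigits S a) n = m} = ∅ := by
      ext a; simpa using fun h => hne ⟨a, h⟩
    simp [this]

theorem coinMeasure_preimage_le (S : Set ℕ) (n : ℕ) (c : ℝ≥0∞)
    (hc : ∀ m, coinMeasure {a | binaryPrefix (maskDigits S a) n = m} ≤ c) {t : Set (ℕ → Fin 2)}
    (ht : ∀ a ∈ t, ∀ b ∈ t, |Real.ofDigits (maskDigits S a) - Real.ofDigits (maskDigits S b)|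
      ≤ 2⁻¹ ^ n) : coinMeasure t ≤ 5 * c := by
  rcases t.eq_empty_or_nonempty with rfl | ⟨b, hb⟩
  · simp
  have hsub : t ⊆ ⋃ i ∈ Finset.range 5, {a | binaryPrefix (maskDigits S a) n =
      binaryPrefix (maskDigits S b) n + i - 2} := by
    intro a ha
    have h := abs_le.1 (ht a ha b hb)
    have h2 : (0 : ℝ) < 2 ^ n := by positivity
    have hinv : (2 : ℝ) ^ n * 2⁻¹ ^ n = 1 := by rw [← mul_pow]; norm_num
    have hpa := two_pow_mul_ofDigits (maskDigits S a) n
    have hpb := two_pow_mul_ofDigits (maskDigits S b) n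
    have ha0 := Real.ofDigits_nonneg fun i => maskDigits S a (i + n)
    have ha1 := Real.ofDigits_le_one fun i => maskDigits S a (i + n)
    have hb0 := Real.ofDigits_nonneg fun i => maskDigits S b (i + n)
    have hb1 := Real.ofDigits_le_one fun i => maskDigits S b (i + n)
    have hup := mul_le_mul_of_nonneg_left h.2 h2.le
    have hlo := mul_le_mul_of_nonneg_left h.1 h2.le
    have hu : (binaryPrefix (maskDigits S a) n : ℝ) ≤ binaryPrefix (maskDigits S b) n + 2 := by
      linarith
    have hl : (binaryPrefix (maskDigits S b) n : ℝ) ≤ binaryPrefix (maskDigits S a) n + 2 := by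
      linarith
    have hu' : binaryPrefix (maskDigits S a) n ≤ binaryPrefix (maskDigits S b) n + 2 := by
      exact_mod_cast hu
    have hl' : binaryPrefix (maskDigits S b) n ≤ binaryPrefix (maskDigits S a) n + 2 := by
      exact_mod_cast hl
    simp only [Set.mem_iUnion, Set.mem_ofPred_eq, Finset.mem_range]
    exact ⟨binaryPrefix (maskDigits S a) n + 2 - binaryPrefix (maskDigits S b) n,
      by omega, by omega⟩
  refine (measure_mono hsub).trans ((measure_biUnion_finset_le _ _).trans ?_)
  refine (Finset.sum_le_card_nsmul _ _ c fun i _ => hc _).trans ?_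
  simp

/-- The places `A ^ k`, `A ^ k + 1`, `A ^ k + 2`. -/
def forcedPlaces (A : ℕ) : Set ℕ := {j | ∃ k : ℕ, A ^ k ≤ j ∧ j < A ^ k + 3}

open Classical in
theorem le_card_free_add {A : ℕ} (hA : 2 ≤ A) (n : ℕ) :
    n ≤ ((Finset.range n).filter (· ∉ forcedPlaces A)).card + (Nat.log A n + 1) * 3 := by
  have h := Finset.card_filter_add_card_filter_not (s := Finset.range n) (· ∈ forcedPlaces A)
  have hsub : (Finset.range n).filter (· ∈ forcedPlaces A) ⊆
      (Finset.range (Nat.log A n + 1)).biUnion fun k => Finset.Ico (A ^ k) (A ^ k + 3) := by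
    intro j hj
    obtain ⟨hjn, k, hk1, hk2⟩ := Finset.mem_filter.1 hj
    rw [Finset.mem_range] at hjn
    simp only [Finset.mem_biUnion, Finset.mem_range, Finset.mem_Ico]
    exact ⟨k, Nat.lt_succ_of_le (Nat.le_log_of_pow_le (by omega) (by omega)), hk1, hk2⟩
  have hcard := (Finset.card_le_card hsub).trans
    (Finset.card_biUnion_le_card_mul _ _ 3 fun k _ => by simp)
  rw [Finset.card_range] at h hcard
  omega

theorem ofDigits_le_of_zero (a : ℕ → Fin 2) {n : ℕ} (h : ∀ i < n, a i = 0) :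
    2 ^ n * Real.ofDigits a ≤ 1 := by
  have h0 : binaryPrefix a n = 0 := by
    induction n with
    | zero => rfl
    | succ n ih => simp [binaryPrefix, ih fun i hi => h i (by omega), h n (by omega)]
  rw [two_pow_mul_ofDigits, h0]
  simpa using Real.ofDigits_le_one _

/-- The point of `[0, 2π)` coded by a digit sequence. -/
def codedAngle (A : ℕ) (a : ℕ → Fin 2) : ℝ :=
  2 * Real.pi * Real.ofDigits (maskDigits (forcedPlaces A) a)

theorem codedAngle_mem (A : ℕ) (a : ℕ → Fin 2) :
    codedAngle A a ∈ Set.Ico 0 (2 * Real.pi) := by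
  set b := maskDigits (forcedPlaces A) a with hb
  have h0 := Real.ofDigits_nonneg b
  have h1 : Real.ofDigits b < 1 := by
    have h := two_pow_mul_ofDigits b 2
    have hb1 : b 1 = 0 := by
      have : 1 ∈ forcedPlaces A := ⟨0, by simp⟩
      simp [hb, maskDigits, this]
    have hle := Real.ofDigits_le_one fun i => b (i + 2)
    have h3 : binaryPrefix b 2 ≤ 2 := by
      have := (b 0).isLt
      simp [binaryPrefix, hb1]; omega
    have h3' : (binaryPrefix b 2 : ℝ) ≤ 2 := by exact_mod_cast h3
    linarith
  have hpi := Real.pi_pos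
  constructor
  · exact mul_nonneg (by positivity) h0
  · change 2 * Real.pi * Real.ofDigits b < _
    nlinarith

theorem half_le_cos_codedAngle (A : ℕ) (a : ℕ → Fin 2) (k : ℕ) :
    1 / 2 ≤ Real.cos (2 ^ A ^ k * codedAngle A a) := by
  unfold codedAngle
  set b := maskDigits (forcedPlaces A) a with hb
  have h := two_pow_mul_ofDigits b (A ^ k)
  have h0 := Real.ofDigits_nonneg fun i => b (i + A ^ k)
  have h8 : 2 ^ 3 * Real.ofDigits (fun i => b (i + A ^ k)) ≤ 1 := by
    refine ofDigits_le_of_zero _ fun i hi => ?_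
    have : i + A ^ k ∈ forcedPlaces A := ⟨k, by omega, by omega⟩
    simp [hb, maskDigits, this]
  have hrw : 2 ^ A ^ k * (2 * Real.pi * Real.ofDigits b) =
      2 * Real.pi * (Real.ofDigits fun i => b (i + A ^ k)) +
        (binaryPrefix b (A ^ k) : ℕ) * (2 * Real.pi) := by
    linear_combination 2 * Real.pi * h
  rw [hrw, Real.cos_add_nat_mul_two_pi, ← Real.cos_pi_div_three]
  have hpi := Real.pi_pos
  refine Real.cos_le_cos_of_nonneg_of_le_pi (by positivity) (by linarith) ?_
  nlinarith

theorem measurable_codedAngle (A : ℕ) : Measurable (codedAngle A) := by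
  have : Continuous fun a => Real.ofDigits (maskDigits (forcedPlaces A) a) := by
    refine Real.continuous_ofDigits.comp (continuous_pi fun j => ?_)
    by_cases hj : j ∈ forcedPlaces A <;> simp [maskDigits, hj] <;> fun_prop
  exact (this.measurable).const_mul _

theorem coinMeasure_codedAngle_le {q : ℕ} (hq : 1 ≤ q) {n : ℕ} (hn : 1 ≤ n) {t : Set ℝ}
    (ht : ∀ x ∈ t, ∀ y ∈ t, |x - y| ≤ 2⁻¹ ^ n) :
    coinMeasure.real (codedAngle (8 ^ q) ⁻¹' t) ≤ 40 * (n : ℝ) ^ (1 / q : ℝ) * 2⁻¹ ^ n := by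
  classical
  have hA : 2 ≤ 8 ^ q := by
    calc 2 ≤ 8 ^ 1 := by norm_num
      _ ≤ 8 ^ q := Nat.pow_le_pow_right (by norm_num) hq
  set F := ((Finset.range n).filter (· ∉ forcedPlaces (8 ^ q))).card with hF
  set L := Nat.log (8 ^ q) n with hL
  have hcard : n ≤ F + (L + 1) * 3 := le_card_free_add hA n
  have h1 : coinMeasure (codedAngle (8 ^ q) ⁻¹' t) ≤ 5 * 2⁻¹ ^ F := by
    refine coinMeasure_preimage_le (forcedPlaces (8 ^ q)) n _
      (fun m => coinMeasure_prefix_le _ n m) fun a ha b hb => ?_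
    have h := ht _ ha _ hb
    rw [codedAngle, codedAngle, ← mul_sub, abs_mul, abs_of_pos Real.two_pi_pos] at h
    refine le_trans ?_ h
    have := Real.pi_gt_three
    exact le_mul_of_one_le_left (abs_nonneg _) (by linarith)
  have h2 : coinMeasure.real (codedAngle (8 ^ q) ⁻¹' t) ≤ 5 * 2⁻¹ ^ F := by
    have := ENNReal.toReal_mono (by finiteness) h1
    simpa [measureReal_def] using this
  have h3 : (2⁻¹ : ℝ) ^ F ≤ 8 ^ (L + 1) * 2⁻¹ ^ n := by
    have h4 : (2⁻¹ : ℝ) ^ (F + (L + 1) * 3) ≤ 2⁻¹ ^ n :=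
      pow_le_pow_of_le_one (by norm_num) (by norm_num) hcard
    have h5 : (8 : ℝ) ^ (L + 1) * 2⁻¹ ^ ((L + 1) * 3) = 1 := by
      rw [mul_comm (L + 1), pow_mul, ← mul_pow]; norm_num
    calc (2⁻¹ : ℝ) ^ F = 8 ^ (L + 1) * 2⁻¹ ^ (F + (L + 1) * 3) := by
          rw [pow_add]; linear_combination -(2⁻¹ : ℝ) ^ F * h5
      _ ≤ _ := by gcongr
  have h6 : (8 : ℝ) ^ L ≤ (n : ℝ) ^ (1 / q : ℝ) := by
    have h7 : (8 ^ q) ^ L ≤ n := Nat.pow_log_le_self _ (by omega)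
    have h8 : ((8 : ℝ) ^ L) ^ q ≤ n := by
      rw [← pow_mul, mul_comm, pow_mul]; exact_mod_cast h7
    have h9 := Real.rpow_le_rpow (by positivity) h8 (show (0 : ℝ) ≤ 1 / q by positivity)
    rwa [one_div, Real.pow_rpow_inv_natCast (by positivity) (by omega), ← one_div] at h9
  have h10 : (0 : ℝ) < 2⁻¹ ^ n := by positivity
  rw [pow_succ] at h3
  nlinarith [mul_le_mul_of_nonneg_right h6 h10.le]

theorem exists_two_inv_pow_lt_le {d : ℝ} (hd0 : 0 < d) {n₀ : ℕ} (hd : d ≤ 2⁻¹ ^ n₀) :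
    ∃ n, n₀ ≤ n ∧ 2⁻¹ ^ (n + 1) < d ∧ d ≤ 2⁻¹ ^ n := by
  obtain ⟨n, h1, h2⟩ := exists_nat_pow_near_of_lt_one hd0
    (hd.trans (pow_le_one₀ (by norm_num) (by norm_num))) (by norm_num : (0 : ℝ) < 2⁻¹)
    (by norm_num)
  refine ⟨n, ?_, h1, h2⟩
  have := (pow_lt_pow_iff_right_of_lt_one₀ (by norm_num : (0 : ℝ) < 2⁻¹) (by norm_num)).1
    (h1.trans_le hd)
  omega

theorem gauge_lower_bound {α : ℝ} (hα : 0 < α) {d : ℝ} {n : ℕ} (h1 : 2⁻¹ ^ (n + 1) < d)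
    (h2 : d ≤ 2⁻¹ ^ n) :
    2⁻¹ ^ n / 2 * ((n : ℝ) * Real.log 2) ^ α ≤ d * |Real.log d| ^ α := by
  have h0 : (0 : ℝ) < 2⁻¹ ^ (n + 1) := by positivity
  have hlog : (n : ℝ) * Real.log 2 ≤ |Real.log d| := by
    have := Real.log_le_log (h0.trans h1) h2
    rw [Real.log_pow, Real.log_inv] at this
    refine le_trans ?_ (neg_le_abs _)
    linarith
  have hpos : 0 ≤ (n : ℝ) * Real.log 2 := mul_nonneg (by positivity) (Real.log_nonneg one_le_two)
  refine mul_le_mul ?_ (Real.rpow_le_rpow hpos hlog hα.le) (by positivity) (h0.trans h1).le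
  rw [pow_succ] at h1
  linarith

theorem mul_coinMeasure_le_gauge {α : ℝ} (hα : 0 < α) {q : ℕ} (hq : 1 ≤ q)
    (hqα : (1 / q : ℝ) < α) {M : ℝ} (hM : 0 ≤ M) :
    ∃ n₀ : ℕ, ∀ (t : Set ℝ) (d : ℝ), 0 ≤ d → d ≤ 2⁻¹ ^ n₀ →
      (∀ x ∈ t, ∀ y ∈ t, |x - y| ≤ d) →
      M * coinMeasure.real (codedAngle (8 ^ q) ⁻¹' t) ≤ d * |Real.log d| ^ α := by
  have hlog2 : 0 < Real.log 2 := Real.log_pos one_lt_two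
  have hlarge : ∀ᶠ n : ℕ in atTop,
      80 * M / Real.log 2 ^ α ≤ (n : ℝ) ^ (α - 1 / q) :=
    ((tendsto_rpow_atTop (sub_pos.2 hqα)).comp tendsto_natCast_atTop_atTop).eventually_ge_atTop _
  obtain ⟨n₀, hn₀⟩ := eventually_atTop.1 (hlarge.and (eventually_ge_atTop 1))
  refine ⟨n₀, fun t d hd0 hd ht => ?_⟩
  rcases hd0.eq_or_lt with rfl | hdpos
  · have htend : Tendsto (fun n : ℕ => 40 * (n : ℝ) ^ (1 / q : ℝ) * 2⁻¹ ^ n) atTop (nhds 0) := by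
      have h := ((tendsto_rpow_mul_exp_neg_mul_atTop_nhds_zero (1 / q : ℝ) (Real.log 2)
        hlog2).comp tendsto_natCast_atTop_atTop).const_mul 40
      rw [mul_zero] at h
      refine h.congr fun n => ?_
      have : Real.exp (-Real.log 2 * n) = 2⁻¹ ^ n := by
        rw [← Real.log_inv, mul_comm, Real.exp_nat_mul, Real.exp_log (by norm_num)]
      simp only [Function.comp_apply]
      rw [this, mul_assoc]
    have hzero : coinMeasure.real (codedAngle (8 ^ q) ⁻¹' t) ≤ 0 := by
      refine ge_of_tendsto htend ((eventually_ge_atTop 1).mono fun n hn => ?_)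
      exact coinMeasure_codedAngle_le hq hn fun x hx y hy => (ht x hx y hy).trans (by positivity)
    simpa using mul_nonpos_of_nonneg_of_nonpos hM hzero
  · obtain ⟨n, hn, h1, h2⟩ := exists_two_inv_pow_lt_le hdpos hd
    obtain ⟨hnM, hn1⟩ := hn₀ n hn
    have hn0 : (0 : ℝ) < n := by exact_mod_cast hn1
    have hp := coinMeasure_codedAngle_le hq hn1 fun x hx y hy => (ht x hx y hy).trans h2
    refine le_trans ?_ (gauge_lower_bound hα h1 h2)
    refine (mul_le_mul_of_nonneg_left hp hM).trans ?_
    rw [div_le_iff₀ (by positivity)] at hnM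
    have hsplit : ((n : ℝ) * Real.log 2) ^ α =
        (n : ℝ) ^ (1 / q : ℝ) * ((n : ℝ) ^ (α - 1 / q) * Real.log 2 ^ α) := by
      rw [Real.mul_rpow hn0.le hlog2.le, ← mul_assoc, ← Real.rpow_add hn0]
      congr 2; ring
    rw [hsplit]
    have h3 : (0 : ℝ) ≤ 2⁻¹ ^ n / 2 * (n : ℝ) ^ (1 / q : ℝ) := by positivity
    linarith [mul_le_mul_of_nonneg_left hnM h3]

theorem codedAngle_mem_Dplus {A : ℕ} (hA : 2 ≤ A) (a : ℕ → Fin 2) :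
    codedAngle A a ∈ Dplus fun z => Complex.exp (lacunary A z) := by
  have hA0 : (0 : ℝ) < A := by positivity
  refine ⟨codedAngle_mem A a, 1 / (8 * A), by positivity, ?_⟩
  filter_upwards [Ico_mem_nhdsLT (show (3 / 4 : ℝ) < 1 by norm_num)] with r hr
  have h := log_le_re_lacunary hA hr.1 hr.2 (half_le_cos_codedAngle A a)
  have hneg : Real.log (1 - r) < 0 := Real.log_neg (by linarith [hr.2]) (by linarith [hr.1])
  rw [Complex.norm_exp, Real.log_exp, abs_of_neg hneg, le_div_iff₀ (by linarith)]
  rwa [one_div_mul_eq_div]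

theorem korenblum_exp_lacunary {A : ℕ} (hA : 2 ≤ A) :
    Korenblum fun z => Complex.exp (lacunary A z) := by
  refine ⟨(differentiableOn_lacunary hA).cexp, 1, 4, one_pos, four_pos, fun z hz => ?_⟩
  rw [mem_ball_zero_iff] at hz
  exact norm_exp_le_of_norm_le hz (norm_lacunary_le hA hz)

theorem korenblum_inv_exp_lacunary {A : ℕ} (hA : 2 ≤ A) :
    Korenblum fun z => (Complex.exp (lacunary A z))⁻¹ := by
  simp only [← Complex.exp_neg]
  refine ⟨(differentiableOn_lacunary hA).neg.cexp, 1, 4, one_pos, four_pos, fun z hz => ?_⟩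
  rw [mem_ball_zero_iff] at hz
  exact norm_exp_le_of_norm_le hz (by rw [norm_neg]; exact norm_lacunary_le hA hz)

theorem le_hausdorffGauge {α : ℝ} (hα : 0 < α) {q : ℕ} (hq : 1 ≤ q) (hqα : (1 / q : ℝ) < α)
    (M : ℕ) {E : Set ℝ} (hE : ∀ a, codedAngle (8 ^ q) a ∈ E) :
    (M : ℝ≥0∞) ≤ hausdorffGauge (fun t => t * |Real.log t| ^ α) E := by
  obtain ⟨n₀, hn₀⟩ := mul_coinMeasure_le_gauge hα hq hqα (M.cast_nonneg (α := ℝ))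
  have hle : (M : ℝ≥0∞) • OuterMeasure.map (codedAngle (8 ^ q)) coinMeasure.toOuterMeasure ≤
      OuterMeasure.mkMetric fun d => ENNReal.ofReal (d.toReal * |Real.log d.toReal| ^ α) := by
    refine OuterMeasure.le_mkMetric _ _ (2⁻¹ ^ n₀) (ENNReal.pow_pos (by simp) _) fun t ht => ?_
    have htop : Metric.ediam t ≠ ⊤ := ne_top_of_le_ne_top (by finiteness) ht
    have hd := hn₀ t (Metric.ediam t).toReal ENNReal.toReal_nonneg
      (by simpa using ENNReal.toReal_mono (by finiteness) ht) fun x hx y hy => by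
        have := ENNReal.toReal_mono htop (Metric.edist_le_ediam_of_mem hx hy)
        rwa [edist_dist, ENNReal.toReal_ofReal dist_nonneg, Real.dist_eq] at this
    have := ENNReal.ofReal_le_ofReal hd
    rw [ENNReal.ofReal_mul (by positivity), ENNReal.ofReal_natCast,
      ofReal_measureReal] at this
    simpa using this
  have h := hle E
  rw [OuterMeasure.coe_mkMetric] at h
  have hpre : codedAngle (8 ^ q) ⁻¹' E = Set.univ := Set.eq_univ_of_forall hE
  simpa [hpre, hausdorffGauge] using h

/-- For any `α > 0` there is a zero-free `f ∈ A^{-∞}` with `f⁻¹ ∈ A^{-∞}` and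
`H_λ(D_+(f)) = ∞` for `λ(t) = t |log t|^α`. -/
theorem stmt3 (α : ℝ) (hα : 0 < α) :
    ∃ f : ℂ → ℂ, Korenblum f ∧ (∀ z ∈ Metric.ball (0:ℂ) 1, f z ≠ 0) ∧
      Korenblum (fun z => (f z)⁻¹) ∧
      hausdorffGauge (fun t => t * |Real.log t| ^ α) (Dplus f) = ⊤ := by
  obtain ⟨q, hqα⟩ := exists_nat_one_div_lt hα
  have hA : 2 ≤ 8 ^ (q + 1) := by
    calc 2 ≤ 8 ^ 1 := by norm_num
      _ ≤ 8 ^ (q + 1) := Nat.pow_le_pow_right (by norm_num) (by omega)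
  refine ⟨fun z => Complex.exp (lacunary (8 ^ (q + 1)) z), korenblum_exp_lacunary hA,
    fun z _ => Complex.exp_ne_zero _, korenblum_inv_exp_lacunary hA, ?_⟩
  refine ENNReal.eq_top_of_forall_nnreal_le fun x => ?_
  obtain ⟨M, hM⟩ := exists_nat_ge x
  exact (by exact_mod_cast hM : (x : ℝ≥0∞) ≤ M).trans <|
    le_hausdorffGauge hα (by omega) (by exact_mod_cast hqα) M (codedAngle_mem_Dplus hA)
end
end

section
/- Let μ > e be a real number and β > 1 an integer satisfying 1 − μ^{−(1−1/√β)} ≥ 1/e. Let f_{μ,β}(z) = ∏_{k=1}^∞ (1 + μ z^{β^k}) (the Horowitz function, which belongs to A^{-∞}). Then the set D_+(f_{μ,β}) has full Lebesgue measure in [0,2π). -/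
open Filter MeasureTheory

noncomputable section

/-- The Horowitz function `f_{μ,β}(z) = ∏_{k=1}^∞ (1 + μ z^{β^k})`. -/
def horowitz (μ : ℝ) (β : ℕ) : ℂ → ℂ :=
  fun z => ∏' k : ℕ, (1 + (μ : ℂ) * z ^ β ^ (k + 1))

theorem abs_im_le_norm_one_add (t : ℝ) {w : ℂ} (hw : ‖w‖ = 1) : |w.im| ≤ ‖1 + (t : ℂ) * w‖ := by
  have h1 : w * starRingEnd ℂ w = 1 := by rw [Complex.mul_conj']; simp [hw]
  have h : (1 + (t : ℂ) * w) * starRingEnd ℂ w = starRingEnd ℂ w + t := by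
    linear_combination (t : ℂ) * h1
  calc |w.im| = |(starRingEnd ℂ w + (t : ℂ)).im| := by simp
    _ ≤ ‖starRingEnd ℂ w + (t : ℂ)‖ := Complex.abs_im_le_norm _
    _ = ‖1 + (t : ℂ) * w‖ := by rw [← h]; simp [hw]

theorem half_le_prod_of_one_sub_le {F : ℕ → ℝ} (hF : ∀ i, 1 - (1 / 2 : ℝ) ^ i / 4 ≤ F i) (L : ℕ) :
    1 / 2 ≤ ∏ i ∈ Finset.range L, F i := by
  have key : 1 / 2 + (1 / 2 : ℝ) ^ L / 2 ≤ ∏ i ∈ Finset.range L, F i := by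
    induction L with
    | zero => norm_num
    | succ L ih =>
      rw [Finset.prod_range_succ]
      have ht0 : 0 < (1 / 2 : ℝ) ^ L := by positivity
      have ht1 : (1 / 2 : ℝ) ^ L ≤ 1 := pow_le_one₀ (by norm_num) (by norm_num)
      have hFL := hF L
      rw [pow_succ]
      set t := (1 / 2 : ℝ) ^ L
      calc 1 / 2 + t * (1 / 2) / 2 ≤ (1 / 2 + t / 2) * (1 - t / 4) := by nlinarith
        _ ≤ _ := mul_le_mul ih hFL (by linarith) (by linarith)
  have : 0 < (1 / 2 : ℝ) ^ L := by positivity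
  linarith

theorem pow_le_half_pow {β n : ℕ} (hβ : 1 < β) {r : ℝ} (hr0 : 0 ≤ r)
    (hr : 1 < (β : ℝ) ^ (n + 1) * (1 - r)) (i : ℕ) :
    r ^ β ^ (n + i + 1) ≤ (1 / 2 : ℝ) ^ i := by
  have hexp : r ≤ Real.exp (-(1 - r)) := by
    have := Real.add_one_le_exp (-(1 - r)); linarith
  have hi : (i : ℝ) ≤ (β : ℝ) ^ i := by
    exact_mod_cast (Nat.lt_pow_self hβ).le
  have hhalf : Real.exp (-1) ≤ 1 / 2 := by
    have h2 : (2 : ℝ) ≤ Real.exp 1 := by have := Real.add_one_le_exp 1; linarith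
    rw [Real.exp_neg, one_div]
    exact inv_anti₀ (by norm_num) h2
  calc r ^ β ^ (n + i + 1) ≤ Real.exp (-(1 - r)) ^ β ^ (n + i + 1) := by gcongr
    _ = Real.exp (-((β : ℝ) ^ i * ((β : ℝ) ^ (n + 1) * (1 - r)))) := by
      rw [← Real.exp_nat_mul]; congr 1; push_cast; ring
    _ ≤ Real.exp (-(i : ℝ)) := by
      gcongr
      have : 0 ≤ (β : ℝ) ^ i := by positivity
      nlinarith
    _ = Real.exp (-1) ^ i := by rw [← Real.exp_nat_mul]; congr 1; ring
    _ ≤ (1 / 2 : ℝ) ^ i := by gcongr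

theorem three_halves_le_norm {μ : ℝ} (hμ : Real.exp 1 < μ) {β : ℕ} (hβ : 1 < β) {p : ℕ} {r : ℝ}
    (hr0 : 0 ≤ r) (hr1 : r ≤ 1) (hr : (β : ℝ) ^ (p + 4) * (1 - r) ≤ 1) {w : ℂ} (hw : ‖w‖ = 1)
    {k : ℕ} (hk : k < p) :
    3 / 2 ≤ ‖1 + ((μ * r ^ β ^ (k + 1) : ℝ) : ℂ) * w‖ := by
  have hβ2 : (2 : ℝ) ≤ β := by exact_mod_cast hβ
  have hb : 1 - (β : ℝ) ^ (k + 1) * (1 - r) ≤ r ^ β ^ (k + 1) := by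
    have := one_add_mul_le_pow (a := r - 1) (by linarith) (β ^ (k + 1))
    push_cast at this
    rw [show 1 + (r - 1) = r by ring] at this
    linarith
  have hsmall : (β : ℝ) ^ (k + 1) * (1 - r) ≤ 1 / 16 := by
    have h1 : (β : ℝ) ^ (k + 1) * 16 ≤ (β : ℝ) ^ (p + 4) := by
      calc (β : ℝ) ^ (k + 1) * 16 ≤ (β : ℝ) ^ p * (β : ℝ) ^ 4 := by
            gcongr
            · linarith
            · exact hk
            · calc (16 : ℝ) = 2 ^ 4 := by norm_num
                _ ≤ _ := by gcongr
        _ = _ := by ring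
    nlinarith
  have hμ' : 2.7 < μ := by have := Real.exp_one_gt_d9; linarith
  have hpos : 0 ≤ μ * r ^ β ^ (k + 1) := by positivity
  have := norm_sub_norm_le (((μ * r ^ β ^ (k + 1) : ℝ) : ℂ) * w) (-1)
  rw [norm_mul, hw, Complex.norm_real, Real.norm_of_nonneg hpos, norm_neg, norm_one,
    sub_neg_eq_add, add_comm _ (1 : ℂ)] at this
  nlinarith

theorem le_prod_norm_one_add {μ : ℝ} (hμ : Real.exp 1 < μ) {β : ℕ} (hβ : 1 < β) {p s : ℕ}
    (hs : 4 * μ ≤ 2 ^ s) {r : ℝ} (hr0 : 0 ≤ r) (hr1 : r ≤ 1)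
    (hr : (β : ℝ) ^ (p + 4) * (1 - r) ≤ 1) (hr' : 1 < (β : ℝ) ^ (p + 4 + 1) * (1 - r))
    {w : ℕ → ℂ} (hw : ∀ k, ‖w k‖ = 1) {η : ℝ} (hη : 0 ≤ η)
    (hB : ∀ k < p + (4 + s), p ≤ k → η ≤ |(w k).im|) (L : ℕ) :
    (3 / 2) ^ p * η ^ (4 + s) * (1 / 2) ≤
      ∏ k ∈ Finset.range (p + (4 + s) + L), ‖1 + ((μ * r ^ β ^ (k + 1) : ℝ) : ℂ) * w k‖ := by
  have hμ0 : 0 < μ := (Real.exp_pos 1).trans hμ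
  rw [Finset.prod_range_add, Finset.prod_range_add]
  gcongr
  · calc (3 / 2 : ℝ) ^ p = ∏ k ∈ Finset.range p, (3 / 2 : ℝ) := by
          rw [Finset.prod_const, Finset.card_range]
      _ ≤ _ := Finset.prod_le_prod (fun _ _ => by norm_num) fun k hk =>
        three_halves_le_norm hμ hβ hr0 hr1 hr (hw k) (Finset.mem_range.mp hk)
  · calc η ^ (4 + s) = ∏ k ∈ Finset.range (4 + s), η := by simp
      _ ≤ _ := Finset.prod_le_prod (fun _ _ => hη) fun k hk =>
        (hB _ (by have := Finset.mem_range.mp hk; omega) (by omega)).trans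
          (abs_im_le_norm_one_add _ (hw _))
  · refine half_le_prod_of_one_sub_le (fun i => ?_) L
    have hpw := pow_le_half_pow hβ hr0 hr' (s + i)
    rw [show p + 4 + (s + i) + 1 = p + (4 + s) + i + 1 by ring] at hpw
    have hbound : μ * r ^ β ^ (p + (4 + s) + i + 1) ≤ (1 / 2 : ℝ) ^ i / 4 := by
      calc μ * r ^ β ^ (p + (4 + s) + i + 1) ≤ (2 ^ s / 4) * (1 / 2 : ℝ) ^ (s + i) := by
            gcongr; linarith
        _ = (2 * (1 / 2) : ℝ) ^ s * (1 / 2 : ℝ) ^ i / 4 := by rw [mul_pow, pow_add]; ring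
        _ = _ := by norm_num
    have hpos : 0 ≤ μ * r ^ β ^ (p + (4 + s) + i + 1) := by positivity
    have := norm_sub_le_norm_add (1 : ℂ)
      (((μ * r ^ β ^ (p + (4 + s) + i + 1) : ℝ) : ℂ) * w (p + (4 + s) + i))
    rw [norm_mul, hw, Complex.norm_real, Real.norm_of_nonneg hpos, norm_one] at this
    linarith

theorem multipliable_horowitz (μ : ℝ) {β : ℕ} (hβ : 1 < β) {z : ℂ} (hz : ‖z‖ < 1) :
    Multipliable fun k : ℕ => 1 + (μ : ℂ) * z ^ β ^ (k + 1) := by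
  refine multipliable_one_add_of_summable ?_
  refine Summable.of_nonneg_of_le (fun _ => norm_nonneg _) (fun k => ?_)
    ((summable_geometric_of_lt_one (norm_nonneg z) hz).mul_left |μ|)
  rw [norm_mul, norm_pow, Complex.norm_real, Real.norm_eq_abs]
  gcongr ?_ * ?_
  exact pow_le_pow_of_le_one (norm_nonneg z) hz.le
    ((Nat.le_succ k).trans (Nat.lt_pow_self hβ).le)

theorem le_norm_horowitz {μ : ℝ} (hμ : Real.exp 1 < μ) {β : ℕ} (hβ : 1 < β) {p s : ℕ}
    (hs : 4 * μ ≤ 2 ^ s) {r : ℝ} (hr0 : 0 ≤ r) (hr1 : r < 1)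
    (hr : (β : ℝ) ^ (p + 4) * (1 - r) ≤ 1) (hr' : 1 < (β : ℝ) ^ (p + 4 + 1) * (1 - r))
    {θ η : ℝ} (hη : 0 ≤ η)
    (hB : ∀ k < p + (4 + s), p ≤ k → η ≤ |Real.sin ((β : ℝ) ^ (k + 1) * θ)|) :
    (3 / 2) ^ p * η ^ (4 + s) * (1 / 2) ≤
      ‖horowitz μ β ((r : ℂ) * Complex.exp (Complex.I * (θ : ℂ)))‖ := by
  set z : ℂ := (r : ℂ) * Complex.exp (Complex.I * (θ : ℂ)) with hz
  set w : ℕ → ℂ := fun k => Complex.exp ((((β : ℝ) ^ (k + 1) * θ : ℝ) : ℂ) * Complex.I) with hwdef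
  have hw : ∀ k, ‖w k‖ = 1 := fun k => Complex.norm_exp_ofReal_mul_I _
  have hwim : ∀ k, (w k).im = Real.sin ((β : ℝ) ^ (k + 1) * θ) :=
    fun k => Complex.exp_ofReal_mul_I_im _
  have hz1 : ‖z‖ < 1 := by
    rw [hz, mul_comm Complex.I, norm_mul, Complex.norm_exp_ofReal_mul_I, Complex.norm_real,
      Real.norm_of_nonneg hr0, mul_one]
    exact hr1
  have hterm : ∀ k, 1 + (μ : ℂ) * z ^ β ^ (k + 1) =
      1 + ((μ * r ^ β ^ (k + 1) : ℝ) : ℂ) * w k := by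
    intro k
    simp only [hz, hwdef]
    rw [mul_pow, ← Complex.exp_nat_mul]
    push_cast
    rw [mul_assoc, show (β : ℂ) ^ (k + 1) * (Complex.I * θ) = (β : ℂ) ^ (k + 1) * θ * Complex.I by
      ring]
  have hlim := (multipliable_horowitz μ hβ hz1).hasProd.tendsto_prod_nat.norm
  refine ge_of_tendsto hlim ?_
  filter_upwards [eventually_ge_atTop (p + (4 + s))] with N hN
  obtain ⟨L, rfl⟩ := Nat.exists_eq_add_of_le hN
  rw [norm_prod, Finset.prod_congr rfl fun k _ => by rw [hterm k]]
  exact le_prod_norm_one_add hμ hβ hs hr0 hr1.le hr hr' hw hη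
    (fun k hk hpk => by rw [hwim]; exact hB k hk hpk) L

theorem norm_coe_two_mul_le_pi_mul_abs_sin (x : ℝ) [Fact (0 < 2 * Real.pi)] :
    ‖((2 * x : ℝ) : AddCircle (2 * Real.pi))‖ ≤ Real.pi * |Real.sin x| := by
  have hπ := Real.pi_pos
  set j : ℤ := round (Real.pi⁻¹ * x) with hj
  have hnorm : ‖((2 * x : ℝ) : AddCircle (2 * Real.pi))‖ = 2 * |x - j * Real.pi| := by
    rw [AddCircle.norm_eq, show (2 * Real.pi)⁻¹ * (2 * x) = Real.pi⁻¹ * x by field_simp, ← hj,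
      show 2 * x - (j : ℝ) * (2 * Real.pi) = 2 * (x - j * Real.pi) by ring, abs_mul, abs_two]
  have hle : |x - j * Real.pi| ≤ Real.pi / 2 := by
    have h := abs_sub_round (Real.pi⁻¹ * x)
    rw [← hj] at h
    rw [show x - j * Real.pi = Real.pi * (Real.pi⁻¹ * x - j) by field_simp, abs_mul,
      abs_of_pos hπ]
    nlinarith
  have hsin := Real.mul_abs_le_abs_sin hle
  have habs : |Real.sin (x - j * Real.pi)| = |Real.sin x| := by
    rw [Real.sin_sub_int_mul_pi, abs_mul]; simp
  rw [habs, div_mul_eq_mul_div, div_le_iff₀ hπ] at hsin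
  rw [hnorm]
  linarith

theorem ae_eventually_le_norm_nsmul {T : ℝ} [hT : Fact (0 < T)] {β : ℕ} (hβ : 1 < β)
    {δ : ℕ → ℝ} (hδ0 : ∀ k, 0 ≤ δ k) (hδ : Summable δ) :
    ∀ᵐ y : AddCircle T, ∀ᶠ k in atTop, δ k < ‖(2 * β ^ k) • y‖ := by
  have hmeas : ∀ k, volume {y : AddCircle T | ‖(2 * β ^ k) • y‖ ≤ δ k} ≤
      ENNReal.ofReal (2 * δ k) := by
    intro k
    have hone : 1 < 2 * β ^ k := by have := Nat.one_le_pow k β (by omega); omega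
    have hpre : {y : AddCircle T | ‖(2 * β ^ k) • y‖ ≤ δ k} =
        (fun y : AddCircle T => (2 * β ^ k) • y) ⁻¹' Metric.closedBall 0 (δ k) := by
      ext y; simp
    rw [hpre, (AddCircle.ergodic_nsmul hone).toMeasurePreserving.measure_preimage
      Metric.isClosed_closedBall.measurableSet.nullMeasurableSet, AddCircle.volume_closedBall]
    exact ENNReal.ofReal_le_ofReal (min_le_right _ _)
  have hsum : ∑' k, volume {y : AddCircle T | ‖(2 * β ^ k) • y‖ ≤ δ k} ≠ ⊤ := by
    refine ne_top_of_le_ne_top ?_ (ENNReal.tsum_le_tsum hmeas)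
    rw [← ENNReal.ofReal_tsum_of_nonneg (fun k => by have := hδ0 k; positivity) (hδ.mul_left 2)]
    exact ENNReal.ofReal_ne_top
  filter_upwards [ae_eventually_notMem hsum] with y hy
  filter_upwards [hy] with k hk
  simpa using hk

theorem ae_eventually_exp_le_abs_sin {β : ℕ} (hβ : 1 < β) {ε : ℝ} (hε : 0 < ε) :
    ∀ᵐ θ ∂(volume.restrict (Set.Ico 0 (2 * Real.pi))),
      ∀ᶠ k : ℕ in atTop, Real.exp (-(ε * k)) ≤ |Real.sin ((β : ℝ) ^ k * θ)| := by
  have hπ := Real.pi_pos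
  have : Fact (0 < 2 * Real.pi) := ⟨by positivity⟩
  have hgeom : Summable fun k : ℕ => Real.pi * Real.exp (-(ε * k)) := by
    refine Summable.mul_left _ ?_
    have := summable_geometric_of_lt_one (Real.exp_pos (-ε)).le (Real.exp_lt_one_iff.mpr (by linarith))
    refine this.congr fun k => ?_
    rw [← Real.exp_nat_mul]; congr 1; ring
  have hcircle := ae_eventually_le_norm_nsmul (T := 2 * Real.pi) hβ
    (fun k => by positivity) hgeom
  have hreal := (AddCircle.measurePreserving_mk (2 * Real.pi) 0).quasiMeasurePreserving.ae hcircle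
  rw [zero_add, ← restrict_Ico_eq_restrict_Ioc] at hreal
  filter_upwards [hreal] with θ hθ
  filter_upwards [hθ] with k hk
  have hcoe : (2 * β ^ k) • (θ : AddCircle (2 * Real.pi)) =
      ((2 * ((β : ℝ) ^ k * θ) : ℝ) : AddCircle (2 * Real.pi)) := by
    rw [← AddCircle.coe_nsmul, nsmul_eq_mul]; push_cast; ring_nf
  rw [hcoe] at hk
  have := hk.le.trans (norm_coe_two_mul_le_pi_mul_abs_sin _)
  exact le_of_mul_le_mul_left this hπ

theorem exists_scale {β : ℕ} (hβ : 1 < β) (P : ℕ) :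
    ∀ᶠ r : ℝ in nhdsWithin 1 (Set.Iio 1), 0 ≤ r ∧ r < 1 ∧ ∃ p, P ≤ p ∧
      (β : ℝ) ^ (p + 4) * (1 - r) ≤ 1 ∧ 1 < (β : ℝ) ^ (p + 4 + 1) * (1 - r) := by
  have hβ1 : (1 : ℝ) < β := by exact_mod_cast hβ
  have hpos : 0 < ((β : ℝ) ^ (P + 4))⁻¹ := by positivity
  have hle1 : ((β : ℝ) ^ (P + 4))⁻¹ ≤ 1 := inv_le_one_of_one_le₀ (one_le_pow₀ hβ1.le)
  filter_upwards [Ioo_mem_nhdsLT (show 1 - ((β : ℝ) ^ (P + 4))⁻¹ < 1 by linarith)]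
    with r ⟨hr, hr1⟩
  have hd : 0 < 1 - r := by linarith
  have hx : (β : ℝ) ^ (P + 4) < (1 - r)⁻¹ := by
    rw [lt_inv_comm₀ (by positivity) hd]; linarith
  obtain ⟨n, hn, hn'⟩ := exists_nat_pow_near
    ((one_le_pow₀ hβ1.le).trans hx.le) hβ1
  have hlt : P + 4 < n + 1 := (pow_lt_pow_iff_right₀ hβ1).mp (hx.trans hn')
  obtain ⟨p, rfl⟩ := Nat.exists_eq_add_of_le' (show 4 ≤ n by omega)
  refine ⟨by linarith, hr1, p, by omega, ?_, ?_⟩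
  · rwa [← le_div_iff₀ hd, one_div]
  · rwa [← div_lt_iff₀ hd, one_div]

theorem mem_Dplus_horowitz {μ : ℝ} (hμ : Real.exp 1 < μ) {β : ℕ} (hβ : 1 < β) {s : ℕ}
    (hs : 4 * μ ≤ 2 ^ s) {θ : ℝ} (hθ : θ ∈ Set.Ico 0 (2 * Real.pi))
    (hsin : ∀ᶠ k : ℕ in atTop,
      Real.exp (-(Real.log (3 / 2) / (2 * (4 + s)) * k)) ≤ |Real.sin ((β : ℝ) ^ k * θ)|) :
    θ ∈ Dplus (horowitz μ β) := by
  set b : ℝ := Real.log (3 / 2) with hb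
  have hb0 : 0 < b := Real.log_pos (by norm_num)
  have hβ1 : (1 : ℝ) < β := by exact_mod_cast hβ
  have hlβ : 0 < Real.log β := Real.log_pos hβ1
  obtain ⟨K, hK⟩ := eventually_atTop.mp hsin
  obtain ⟨P, hP⟩ := exists_nat_ge (4 * ((4 + s) / 2 + Real.log 2 / b) + 5)
  refine ⟨hθ, b / (8 * Real.log β), by positivity, ?_⟩
  filter_upwards [exists_scale hβ (max K P)] with r ⟨hr0, hr1, p, hp, hr, hr'⟩
  have hpK : K ≤ p := (le_max_left _ _).trans hp
  have hpP : (P : ℝ) ≤ p := by exact_mod_cast (le_max_right _ _).trans hp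
  set ε : ℝ := b / (2 * (4 + s)) with hε
  have hε0 : 0 < ε := by positivity
  have hlow := le_norm_horowitz hμ hβ hs hr0 hr1 hr hr' (θ := θ)
    (η := Real.exp (-(ε * (p + (4 + s))))) (Real.exp_pos _).le (by
      intro k hk hpk
      refine le_trans ?_ (hK (k + 1) (by omega))
      gcongr
      exact_mod_cast hk)
  have hlog := Real.log_le_log (by positivity) hlow
  rw [Real.log_mul (by positivity) (by norm_num), Real.log_mul (by positivity) (by positivity),
    Real.log_pow, Real.log_pow, Real.log_exp, ← hb, one_div, Real.log_inv] at hlog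
  have hmid : ((4 + s : ℕ) : ℝ) * -(ε * (p + (4 + s))) = -(b / 2 * (p + (4 + s))) := by
    rw [hε]; push_cast; field_simp
  rw [hmid] at hlog
  have hd : 0 < 1 - r := by linarith
  have hlogr : |Real.log (1 - r)| ≤ (p + 5) * Real.log β := by
    rw [abs_of_nonpos (Real.log_nonpos hd.le (by linarith))]
    have h := Real.log_pos hr'
    rw [Real.log_mul (by positivity) hd.ne', Real.log_pow] at h
    push_cast at h
    linarith
  have hr0' : r ≠ 0 := by
    rintro rfl
    have : (1 : ℝ) < (β : ℝ) ^ (p + 4) := one_lt_pow₀ hβ1 (by omega)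
    linarith
  have hlogpos : 0 < |Real.log (1 - r)| := by
    refine abs_pos.mpr (Real.log_neg hd ?_).ne
    have := lt_of_le_of_ne hr0 hr0'.symm
    linarith
  rw [le_div_iff₀ hlogpos]
  refine le_trans ?_ hlog
  calc b / (8 * Real.log β) * |Real.log (1 - r)|
      ≤ b / (8 * Real.log β) * ((p + 5) * Real.log β) := by gcongr
    _ = b * ((p + 5) / 8) := by field_simp
    _ ≤ b * (p / 2 - (4 + s) / 2 - Real.log 2 / b) := by
      gcongr
      have : 0 ≤ Real.log 2 / b := by have := Real.log_pos one_lt_two; positivity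
      linarith
    _ = p * b + -(b / 2 * (p + (4 + s))) + -Real.log 2 := by field_simp; ring

/-- If `μ > e` and the integer `β > 1` satisfy `1 - μ^{-(1-1/√β)} ≥ 1/e`, then
`D_+(f_{μ,β})` has full Lebesgue measure in `[0, 2π)`. -/
theorem stmt4 (μ : ℝ) (β : ℕ) (hμ : Real.exp 1 < μ) (hβ : 1 < β)
    (hcond : 1 / Real.exp 1 ≤ 1 - μ ^ (-(1 - 1 / Real.sqrt (β : ℝ)))) :
    volume (Set.Ico 0 (2 * Real.pi) \ Dplus (horowitz μ β)) = 0 := by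
  obtain ⟨s, hs⟩ := pow_unbounded_of_one_lt (4 * μ) (one_lt_two (α := ℝ))
  have hε : 0 < Real.log (3 / 2) / (2 * (4 + s)) :=
    div_pos (Real.log_pos (by norm_num)) (by positivity)
  have hae := (ae_restrict_iff' measurableSet_Ico).mp (ae_eventually_exp_le_abs_sin hβ hε)
  refine measure_mono_null ?_ (ae_iff.mp hae)
  rintro θ ⟨hθ, hnot⟩ hmem
  exact hnot (mem_Dplus_horowitz hμ hβ hs.le hθ (hmem hθ))
end
end

section
/- Let λ(t) = t·|log t|. Suppose f is in the Korenblum class A^{-∞} and |f| is bounded from below on the unit disc by a positive constant. Then the set G_+(f) is a countable union of sets of finite Hausdorff measure H_λ. -/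
open Filter MeasureTheory

noncomputable section

/-- `G_+(f)`: the set of `θ ∈ [0, 2π)` such that
`limsup_{r→1⁻} log|f(re^{iθ})| / |log(1-r)| > 0`. -/
def Gplus (f : ℂ → ℂ) : Set ℝ :=
  {θ | θ ∈ Set.Ico 0 (2 * Real.pi) ∧
    ∃ c : ℝ, 0 < c ∧ ∃ᶠ r : ℝ in nhdsWithin 1 (Set.Iio 1),
      c ≤ Real.log ‖f ((r : ℂ) * Complex.exp (Complex.I * (θ : ℂ)))‖ / |Real.log (1 - r)|}

/-- A set that is covered at all scales by balls carrying, for a finite content `μ`, mass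
comparable to the gauge `t |log t|` has finite Hausdorff measure for that gauge. -/
theorem hausdorffGauge_lt_top_of_forall_exists_mass_le {U : Filter ℝ} [U.NeBot]
    (μ : ℝ → Set ℝ → ℝ) {S : Set ℝ} {c T : ℝ} (hc : 0 < c)
    (hμ : ∀ᶠ R in U, ∀ (s : Finset ℝ) (ρ : ℝ → ℝ),
      (s : Set ℝ).PairwiseDisjoint (fun x => Metric.closedBall x (ρ x)) →
        ∑ x ∈ s, μ R (Metric.closedBall x (ρ x)) ≤ T)
    (hS : ∀ ε > 0, ∀ x ∈ S, ∃ ρ, 0 < ρ ∧ ρ < ε ∧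
      ∀ᶠ R in U, c * (ρ * |Real.log ρ|) ≤ μ R (Metric.closedBall x ρ)) :
    hausdorffGauge (fun t => t * |Real.log t|) S < ⊤ := by
  have key : ∀ n : ℕ, ∃ u : Set ℝ, ∃ ρ : ℝ → ℝ, u.Countable ∧
      (∀ x ∈ u, 0 < ρ x ∧ 10 * ρ x ≤ 1 / ((n : ℝ) + 1)) ∧
      (S ⊆ ⋃ x : u, Metric.closedBall (x : ℝ) (5 * ρ x)) ∧
      ∀ s : Finset ℝ, (s : Set ℝ) ⊆ u → ∑ x ∈ s, ρ x * |Real.log (ρ x)| ≤ T / c := by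
    intro n
    have hε : (0 : ℝ) < 1 / ((n : ℝ) + 1) / 10 := by positivity
    choose! ρ hρ0 hρ1 hρ2 using hS _ hε
    obtain ⟨u, huS, hud, hcov⟩ := Vitali.exists_disjoint_subfamily_covering_enlargement_closedBall
      S (fun x => x) ρ _ (fun x hx => (hρ1 x hx).le) 5 (by norm_num)
    refine ⟨u, ρ, ?_, ?_, ?_, ?_⟩
    · refine hud.countable_of_nonempty_interior fun x hx => ⟨x, ?_⟩
      exact Metric.ball_subset_interior_closedBall (Metric.mem_ball_self (hρ0 x (huS hx)))
    · intro x hx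
      exact ⟨hρ0 x (huS hx), by linarith [hρ1 x (huS hx)]⟩
    · intro x hx
      obtain ⟨b, hb, hsub⟩ := hcov x hx
      exact Set.mem_iUnion.2 ⟨⟨b, hb⟩, hsub (Metric.mem_closedBall_self (hρ0 x hx).le)⟩
    · intro s hs
      have h1 : ∀ᶠ R in U, ∀ x ∈ s,
          c * (ρ x * |Real.log (ρ x)|) ≤ μ R (Metric.closedBall x (ρ x)) :=
        (Filter.eventually_all_finset s).2 fun x hx => hρ2 x (huS (hs hx))
      obtain ⟨R, hR1, hR2⟩ := (h1.and hμ).exists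
      rw [le_div_iff₀ hc, mul_comm, Finset.mul_sum]
      exact (Finset.sum_le_sum hR1).trans (hR2 s ρ (hud.subset hs))
  choose u ρ hcount hρ hcov hsum using key
  have : ∀ n, Countable (u n) := fun n => (hcount n).to_subtype
  have hdiam : ∀ n (x : u n), Metric.ediam (Metric.closedBall (x : ℝ) (5 * ρ n x)) =
      ENNReal.ofReal (10 * ρ n x) := by
    intro n x
    rw [Real.closedBall_eq_Icc, Real.ediam_Icc]
    congr 1; ring
  have hle := Measure.mkMetric_le_liminf_tsum (ι := fun n => u n) S (l := atTop)
    (fun n : ℕ => ENNReal.ofReal (1 / ((n : ℝ) + 1)))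
    (by simpa using ENNReal.tendsto_ofReal (tendsto_one_div_add_atTop_nhds_zero_nat (𝕜 := ℝ)))
    (fun n x => Metric.closedBall (x : ℝ) (5 * ρ n x))
    (Eventually.of_forall fun n x => by
      rw [hdiam]; exact ENNReal.ofReal_le_ofReal (hρ n x x.2).2)
    (Eventually.of_forall hcov)
    (fun d => ENNReal.ofReal (d.toReal * |Real.log d.toReal|))
  refine (hle.trans (?_ : _ ≤ ENNReal.ofReal (10 * (T / c)))).trans_lt ENNReal.ofReal_lt_top
  refine (liminf_le_liminf (v := fun _ => ENNReal.ofReal (10 * (T / c)))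
    (Eventually.of_forall fun n => ?_)).trans (liminf_const _).le
  have hterm : ∀ x : u n, ENNReal.ofReal ((10 * ρ n x) * |Real.log (10 * ρ n x)|) ≤
      ENNReal.ofReal (10 * (ρ n x * |Real.log (ρ n x)|)) := by
    intro x
    obtain ⟨h0, h1⟩ := hρ n x x.2
    have h2 : 1 / ((n : ℝ) + 1) ≤ 1 := by
      rw [div_le_one (by positivity)]; linarith [n.cast_nonneg (α := ℝ)]
    have h3 : |Real.log (10 * ρ n x)| ≤ |Real.log (ρ n x)| := by
      rw [abs_of_nonpos (Real.log_nonpos (by linarith) (by linarith)),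
        abs_of_nonpos (Real.log_nonpos (by linarith) (by linarith))]
      have := Real.log_le_log h0 (by linarith : ρ n x ≤ 10 * ρ n x)
      linarith
    apply ENNReal.ofReal_le_ofReal
    rw [mul_assoc]
    gcongr
  calc ∑' x : u n, ENNReal.ofReal
        ((Metric.ediam (Metric.closedBall (x : ℝ) (5 * ρ n x))).toReal *
          |Real.log (Metric.ediam (Metric.closedBall (x : ℝ) (5 * ρ n x))).toReal|)
      ≤ ∑' x : u n, ENNReal.ofReal (10 * (ρ n x * |Real.log (ρ n x)|)) := by
        refine ENNReal.tsum_le_tsum fun x => ?_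
        rw [hdiam, ENNReal.toReal_ofReal (by linarith [(hρ n x x.2).1])]
        exact hterm x
    _ ≤ ENNReal.ofReal (10 * (T / c)) := by
        rw [ENNReal.tsum_eq_iSup_sum]
        refine iSup_le fun s => ?_
        rw [← ENNReal.ofReal_sum_of_nonneg fun x _ => by
          have := (hρ n x x.2).1; positivity]
        refine ENNReal.ofReal_le_ofReal ?_
        rw [← Finset.mul_sum]
        gcongr
        simpa using hsum n (s.map (Function.Embedding.subtype _)) (by simp)

theorem le_sum_indicator_of_mul_le {P δ x : ℝ} (hδ : 0 < δ) (h1 : P * δ ≤ 10)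
    (h2 : P * x ^ 2 ≤ 10 * δ) (J : ℕ) :
    P * δ ≤ 40 * (∑ j ∈ Finset.range J,
      (1 / 4) ^ j * (if |x| ≤ 2 ^ j * δ then 1 else 0) + (1 / 4) ^ J) := by
  induction J with
  | zero => simp; linarith
  | succ J ih =>
    have hp : (0 : ℝ) < (1 / 4) ^ J := by positivity
    by_cases hx : |x| ≤ 2 ^ J * δ
    · rw [Finset.sum_range_succ, if_pos hx, pow_succ]
      linarith
    · have hs : 0 ≤ ∑ j ∈ Finset.range (J + 1),
          ((1 : ℝ) / 4) ^ j * (if |x| ≤ 2 ^ j * δ then 1 else 0) :=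
        Finset.sum_nonneg fun j _ => by positivity
      suffices P * δ ≤ 10 * (1 / 4) ^ J by rw [pow_succ]; linarith
      rcases le_or_gt P 0 with hP | hP
      · nlinarith
      have h3 : (2 ^ J * δ) ^ 2 ≤ x ^ 2 := by
        rw [← sq_abs x]; exact pow_le_pow_left₀ (by positivity) (not_le.1 hx).le 2
      have h4 : P * (2 ^ J * δ) ^ 2 ≤ 10 * δ := (by gcongr : _ ≤ P * x ^ 2).trans h2
      have h5 : ((2 : ℝ) ^ J) ^ 2 = 4 ^ J := by rw [← pow_mul, mul_comm, pow_mul]; norm_num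
      rw [mul_pow, h5] at h4
      have h6 : P * δ * 4 ^ J ≤ 10 := by
        refine le_of_mul_le_mul_right ?_ hδ
        linarith
      rw [one_div, inv_pow, ← div_eq_mul_inv, le_div_iff₀ (by positivity)]
      exact h6

theorem poissonKernel_circleMap_bounds {R δ θ t : ℝ} (hR : 0 < R) (hδ : 0 < δ) (hδ' : δ ≤ 1 / 2)
    (ht : |t - θ| ≤ Real.pi) :
    poissonKernel 0 (circleMap 0 (R * (1 - δ)) θ) (circleMap 0 R t) * δ ≤ 10 ∧
      poissonKernel 0 (circleMap 0 (R * (1 - δ)) θ) (circleMap 0 R t) * (t - θ) ^ 2 ≤ 10 * δ ∧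
      0 ≤ poissonKernel 0 (circleMap 0 (R * (1 - δ)) θ) (circleMap 0 R t) := by
  have hn : ‖circleMap 0 R t - circleMap 0 (R * (1 - δ)) θ‖ ^ 2 =
      R ^ 2 * (δ ^ 2 + 2 * (1 - δ) * (1 - Real.cos (t - θ))) := by
    rw [← Complex.normSq_eq_norm_sq, Complex.normSq_apply, Real.cos_sub]
    simp only [circleMap, Complex.exp_mul_I, ← Complex.ofReal_cos, ← Complex.ofReal_sin, zero_add,
      Complex.sub_re, Complex.sub_im, Complex.mul_re, Complex.mul_im, Complex.add_re,
      Complex.add_im, Complex.ofReal_re, Complex.ofReal_im, Complex.I_re, Complex.I_im]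
    have e1 := Real.sin_sq_add_cos_sq t
    have e2 := Real.sin_sq_add_cos_sq θ
    linear_combination R ^ 2 * e1 + R ^ 2 * (1 - δ) ^ 2 * e2
  have hP : poissonKernel 0 (circleMap 0 (R * (1 - δ)) θ) (circleMap 0 R t) =
      (δ * (2 - δ)) / (δ ^ 2 + 2 * (1 - δ) * (1 - Real.cos (t - θ))) := by
    rw [poissonKernel_def]
    simp only [sub_zero, hn, norm_circleMap_zero, sq_abs]
    rw [← mul_div_mul_left (δ * (2 - δ)) _ (pow_pos hR 2).ne']
    ring_nf
  have hcos := Real.cos_le_one_sub_mul_cos_sq ht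
  have hc0 : 0 ≤ 1 - Real.cos (t - θ) := by linarith [Real.cos_le_one (t - θ)]
  have hpi : Real.pi ^ 2 ≤ 10 := by nlinarith [Real.pi_lt_d2, Real.pi_pos]
  have hpi2 : 1 / 5 ≤ 2 / Real.pi ^ 2 := by
    rw [div_le_div_iff₀ (by norm_num) (by positivity)]; linarith
  have hquad : (t - θ) ^ 2 / 5 ≤ 1 - Real.cos (t - θ) := by
    nlinarith [sq_nonneg (t - θ)]
  have hq : 0 ≤ (1 - 2 * δ) * (1 - Real.cos (t - θ)) := mul_nonneg (by linarith) hc0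
  have hden : 0 < δ ^ 2 + 2 * (1 - δ) * (1 - Real.cos (t - θ)) := by nlinarith
  rw [hP]
  refine ⟨?_, ?_, div_nonneg (by nlinarith) hden.le⟩
  · rw [div_mul_eq_mul_div, div_le_iff₀ hden]
    nlinarith
  · rw [div_mul_eq_mul_div, div_le_iff₀ hden]
    have : (t - θ) ^ 2 ≤ 5 * (δ ^ 2 + 2 * (1 - δ) * (1 - Real.cos (t - θ))) := by nlinarith
    nlinarith [mul_le_mul_of_nonneg_left this hδ.le, mul_nonneg hδ.le (mul_nonneg hδ.le (sq_nonneg (t - θ)))]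

/-- The mass that the density `t ↦ h (R e^{it})` on `[-π, 3π]` gives to a set of angles. -/
def circleMass (h : ℂ → ℝ) (R : ℝ) (A : Set ℝ) : ℝ :=
  ∫ t in Set.Icc (-Real.pi) (3 * Real.pi), A.indicator (fun t => h (circleMap 0 R t)) t

section PositiveHarmonic

open InnerProductSpace

variable {h : ℂ → ℝ} {R : ℝ}

theorem circleMap_mem_unit_ball (hR0 : 0 < R) (hR1 : R < 1) (t : ℝ) :
    circleMap 0 R t ∈ Metric.ball (0 : ℂ) 1 := by
  simpa [abs_of_pos hR0] using hR1

theorem continuous_comp_circleMap (hh : HarmonicOnNhd h (Metric.ball 0 1))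
    (hR0 : 0 < R) (hR1 : R < 1) : Continuous fun t => h (circleMap 0 R t) :=
  hh.continuousOn.comp_continuous (continuous_circleMap 0 R) (circleMap_mem_unit_ball hR0 hR1)

theorem integral_comp_circleMap (hh : HarmonicOnNhd h (Metric.ball 0 1))
    (hR0 : 0 < R) (hR1 : R < 1) :
    ∫ t in Set.Icc (-Real.pi) (3 * Real.pi), h (circleMap 0 R t) = 4 * Real.pi * h 0 := by
  have hpi := Real.pi_pos
  have hcont := continuous_comp_circleMap hh hR0 hR1
  have havg : ∫ t in (0 : ℝ)..2 * Real.pi, h (circleMap 0 R t) = 2 * Real.pi * h 0 := by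
    have := InnerProductSpace.HarmonicOnNhd.circleAverage_eq (f := h) (c := 0) (R := R)
      (hh.mono (Metric.closedBall_subset_ball (by rwa [abs_of_pos hR0])))
    rw [Real.circleAverage_def, smul_eq_mul] at this
    rw [← this]
    field_simp
  have hper : Function.Periodic (fun t => h (circleMap 0 R t)) (2 * Real.pi) :=
    fun t => by simp [periodic_circleMap 0 R t]
  have h1 := hper.intervalIntegral_add_eq (-Real.pi) 0
  have h2 := hper.intervalIntegral_add_eq Real.pi 0
  rw [integral_Icc_eq_integral_Ioc, ← intervalIntegral.integral_of_le (by linarith),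
    ← intervalIntegral.integral_add_adjacent_intervals (b := Real.pi)
      (hcont.intervalIntegrable _ _) (hcont.intervalIntegrable _ _)]
  rw [zero_add, show -Real.pi + 2 * Real.pi = Real.pi by ring] at h1
  rw [zero_add, show Real.pi + 2 * Real.pi = 3 * Real.pi by ring] at h2
  rw [h1, h2, havg]
  ring

theorem sum_circleMass_closedBall_le (hh : HarmonicOnNhd h (Metric.ball 0 1))
    (hpos : ∀ z ∈ Metric.ball (0 : ℂ) 1, 0 ≤ h z) (hR0 : 0 < R) (hR1 : R < 1)
    (s : Finset ℝ) (ρ : ℝ → ℝ)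
    (hs : (s : Set ℝ).PairwiseDisjoint fun x => Metric.closedBall x (ρ x)) :
    ∑ x ∈ s, circleMass h R (Metric.closedBall x (ρ x)) ≤ 4 * Real.pi * h 0 := by
  have hint : IntegrableOn (fun t => h (circleMap 0 R t))
      (Set.Icc (-Real.pi) (3 * Real.pi)) :=
    (continuous_comp_circleMap hh hR0 hR1).integrableOn_Icc
  rw [← integral_comp_circleMap hh hR0 hR1]
  unfold circleMass
  rw [← integral_finsetSum _ fun x _ => hint.indicator Metric.isClosed_closedBall.measurableSet]
  refine integral_mono (integrable_finsetSum _ fun x _ =>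
    hint.indicator Metric.isClosed_closedBall.measurableSet) hint fun t => ?_
  have := congrFun (Finset.indicator_biUnion s (fun x => Metric.closedBall x (ρ x))
    (f := fun t => h (circleMap 0 R t)) hs) t
  simp only at this ⊢
  rw [← this]
  exact Set.indicator_le_self' (fun _ _ => hpos _ (circleMap_mem_unit_ball hR0 hR1 t)) t

/-- The Poisson integral of a positive harmonic function is controlled by the masses of dyadic
intervals. -/
theorem mul_le_sum_circleMass (hh : HarmonicOnNhd h (Metric.ball 0 1))
    (hpos : ∀ z ∈ Metric.ball (0 : ℂ) 1, 0 ≤ h z) (hR0 : 0 < R) (hR1 : R < 1) {δ θ : ℝ}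
    (hδ : 0 < δ) (hδ' : δ ≤ 1 / 2) (hθ : θ ∈ Set.Ico 0 (2 * Real.pi)) (J : ℕ) :
    h (circleMap 0 (R * (1 - δ)) θ) * δ ≤ 7 * (∑ j ∈ Finset.range J,
      (1 / 4) ^ j * circleMass h R (Metric.closedBall θ (2 ^ j * δ)) +
        (1 / 4) ^ J * (4 * Real.pi * h 0)) := by
  have hpi := Real.pi_pos
  set w := circleMap 0 (R * (1 - δ)) θ with hw
  set g : ℝ → ℝ := fun t => h (circleMap 0 R t) with hg
  set P : ℝ → ℝ := fun t => poissonKernel 0 w (circleMap 0 R t) with hPdef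
  have hg0 : ∀ t, 0 ≤ g t := fun t => hpos _ (circleMap_mem_unit_ball hR0 hR1 t)
  have hint : IntegrableOn g (Set.Icc (-Real.pi) (3 * Real.pi)) :=
    (continuous_comp_circleMap hh hR0 hR1).integrableOn_Icc
  have hwR : w ∈ Metric.ball (0 : ℂ) R := by
    rw [mem_ball_zero_iff, hw, norm_circleMap_zero, abs_of_pos (by nlinarith)]
    nlinarith
  have hrep : h w = (2 * Real.pi)⁻¹ * ∫ t in Set.Icc (θ - Real.pi) (θ + Real.pi), P t * g t := by
    rw [← HarmonicOnNhd.circleAverage_poissonKernel_smul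
      (hh.mono (Metric.closedBall_subset_ball hR1)) hwR,
      Real.circleAverage_eq_integral_add (θ - Real.pi), smul_eq_mul,
      intervalIntegral.integral_comp_add_right
        (fun t => (poissonKernel 0 w • h) (circleMap 0 R t)),
      integral_Icc_eq_integral_Ioc, ← intervalIntegral.integral_of_le (by linarith)]
    congr 2
    · ring
    · ring
  set Φ : ℝ → ℝ := fun t => ∑ j ∈ Finset.range J,
      (1 / 4) ^ j * (Metric.closedBall θ (2 ^ j * δ)).indicator g t + (1 / 4) ^ J * g t with hΦ
  have hind : ∀ j : ℕ, IntegrableOn (fun t =>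
      (1 / 4) ^ j * (Metric.closedBall θ (2 ^ j * δ)).indicator g t)
      (Set.Icc (-Real.pi) (3 * Real.pi)) := fun j =>
    (hint.indicator Metric.isClosed_closedBall.measurableSet).const_mul _
  have hΦint : IntegrableOn Φ (Set.Icc (-Real.pi) (3 * Real.pi)) :=
    (integrable_finsetSum _ fun j _ => hind j).add (hint.const_mul _)
  have hΦ0 : ∀ t, 0 ≤ Φ t := fun t => by
    refine add_nonneg (Finset.sum_nonneg fun j _ => mul_nonneg (by positivity) ?_)
      (mul_nonneg (by positivity) (hg0 t))
    exact Set.indicator_nonneg (fun t _ => hg0 t) t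
  have hΦI : ∫ t in Set.Icc (-Real.pi) (3 * Real.pi), Φ t = ∑ j ∈ Finset.range J,
      (1 / 4) ^ j * circleMass h R (Metric.closedBall θ (2 ^ j * δ)) +
        (1 / 4) ^ J * (4 * Real.pi * h 0) := by
    rw [← integral_comp_circleMap hh hR0 hR1, ← integral_const_mul]
    simp only [circleMass, ← integral_const_mul]
    rw [← integral_finsetSum _ fun j _ => hind j, ← integral_add
      (integrable_finsetSum _ fun j _ => hind j) (hint.const_mul _)]
  have hle : (∫ t in Set.Icc (θ - Real.pi) (θ + Real.pi), P t * g t) * δ ≤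
      40 * ∫ t in Set.Icc (-Real.pi) (3 * Real.pi), Φ t := by
    have hsub : Set.Icc (θ - Real.pi) (θ + Real.pi) ⊆ Set.Icc (-Real.pi) (3 * Real.pi) :=
      Set.Icc_subset_Icc (by linarith [hθ.1]) (by linarith [hθ.2])
    calc _ = ∫ t in Set.Icc (θ - Real.pi) (θ + Real.pi), P t * g t * δ :=
          (integral_mul_const _ _).symm
      _ ≤ ∫ t in Set.Icc (θ - Real.pi) (θ + Real.pi), 40 * Φ t := by
          have hbd : ∀ t ∈ Set.Icc (θ - Real.pi) (θ + Real.pi), |t - θ| ≤ Real.pi :=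
            fun t ht => abs_le.2 ⟨by linarith [ht.1], by linarith [ht.2]⟩
          refine integral_mono_of_nonneg ?_ ((hΦint.mono_set hsub).const_mul _) ?_
          · refine (ae_restrict_iff' measurableSet_Icc).2 (Eventually.of_forall fun t ht => ?_)
            exact mul_nonneg (mul_nonneg
              (poissonKernel_circleMap_bounds hR0 hδ hδ' (hbd t ht)).2.2 (hg0 t)) hδ.le
          · refine (ae_restrict_iff' measurableSet_Icc).2 (Eventually.of_forall fun t ht => ?_)
            obtain ⟨h1, h2, -⟩ := poissonKernel_circleMap_bounds hR0 hδ hδ' (hbd t ht)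
            have h3 := mul_le_mul_of_nonneg_right (le_sum_indicator_of_mul_le hδ h1 h2 J) (hg0 t)
            calc P t * g t * δ = P t * δ * g t := by ring
              _ ≤ _ := h3
              _ = 40 * Φ t := by
                rw [hΦ, mul_assoc, add_mul, Finset.sum_mul]
                congr 2
                refine Finset.sum_congr rfl fun j _ => ?_
                by_cases htj : |t - θ| ≤ 2 ^ j * δ
                · rw [if_pos htj, mul_one, Set.indicator_of_mem]
                  exact Metric.mem_closedBall.2 htj
                · rw [if_neg htj, Set.indicator_of_notMem, mul_zero, zero_mul]
                  exact fun hmem => htj (Metric.mem_closedBall.1 hmem)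
      _ = 40 * ∫ t in Set.Icc (θ - Real.pi) (θ + Real.pi), Φ t := integral_const_mul _ _
      _ ≤ _ := by
          refine mul_le_mul_of_nonneg_left ?_ (by norm_num)
          exact setIntegral_mono_set hΦint (Eventually.of_forall hΦ0) hsub.eventuallyLE
  have hI0 : 0 ≤ ∫ t in Set.Icc (-Real.pi) (3 * Real.pi), Φ t :=
    integral_nonneg hΦ0
  rw [← hΦI, hrep]
  calc _ = (2 * Real.pi)⁻¹ * ((∫ t in Set.Icc (θ - Real.pi) (θ + Real.pi), P t * g t) * δ) := by
        ring
    _ ≤ (2 * Real.pi)⁻¹ * (40 * ∫ t in Set.Icc (-Real.pi) (3 * Real.pi), Φ t) := by gcongr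
    _ = ((2 * Real.pi)⁻¹ * 40) * ∫ t in Set.Icc (-Real.pi) (3 * Real.pi), Φ t := by ring
    _ ≤ _ := by
        gcongr
        rw [inv_mul_le_iff₀ (by positivity)]
        linarith [Real.pi_gt_three]

/-- Where a positive harmonic function grows like `|log (1 - r)|` along a radius, its boundary
mass is at least `ρ |log ρ|`, up to a constant, on arbitrarily short intervals. -/
theorem exists_circleMass_ge (hh : HarmonicOnNhd h (Metric.ball 0 1))
    (hpos : ∀ z ∈ Metric.ball (0 : ℂ) 1, 0 ≤ h z) (U : Ultrafilter ℝ)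
    (hU : (U : Filter ℝ) ≤ nhdsWithin 1 (Set.Iio 1)) {c θ : ℝ} (hc : 0 < c)
    (hθ : θ ∈ Set.Ico 0 (2 * Real.pi))
    (hfreq : ∃ᶠ r : ℝ in nhdsWithin 1 (Set.Iio 1),
      c * |Real.log (1 - r)| ≤ h (circleMap 0 r θ)) {ε : ℝ} (hε : 0 < ε) :
    ∃ ρ, 0 < ρ ∧ ρ < ε ∧ ∀ᶠ R in (U : Filter ℝ),
      c / 56 * (ρ * |Real.log ρ|) ≤ circleMass h R (Metric.closedBall θ ρ) := by
  wlog hε1 : ε ≤ 1 generalizing ε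
  · obtain ⟨ρ, h0, h1, h2⟩ := this one_pos le_rfl
    exact ⟨ρ, h0, h1.trans (not_le.1 hε1), h2⟩
  by_contra! hcon
  have hpi := Real.pi_pos
  have hT : 0 ≤ 4 * Real.pi * h 0 := mul_nonneg (by positivity) (hpos 0 (by simp))
  set T := 4 * Real.pi * h 0 with hTdef
  obtain ⟨η, hη0, hη⟩ : ∃ η > 0, 7 * η * T / ε ^ 2 < c / 8 := by
    refine ⟨c * ε ^ 2 / (56 * (T + 1)) , by positivity, ?_⟩
    rw [div_lt_div_iff₀ (by positivity) (by norm_num), mul_div_assoc', div_mul_eq_mul_div,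
      div_mul_eq_mul_div, div_lt_iff₀ (by positivity)]
    have : 0 < c * ε ^ 2 := by positivity
    nlinarith
  have hnear : ∀ᶠ r : ℝ in nhdsWithin 1 (Set.Iio 1), r < 1 ∧ 1 - min η (1 / 2) < r :=
    (eventually_mem_nhdsWithin (a := (1 : ℝ)) (s := Set.Iio 1)).and
      (mem_nhdsWithin_of_mem_nhds (lt_mem_nhds (by
        have : 0 < min η (1 / 2) := by positivity
        linarith)))
  obtain ⟨r, hr, hr1, hr2⟩ := (hfreq.and_eventually hnear).exists
  obtain ⟨δ, rfl⟩ : ∃ δ, r = 1 - δ := ⟨1 - r, by ring⟩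
  rw [sub_sub_cancel] at hr
  have hδ : 0 < δ := by linarith
  have hδη : δ < η := by linarith [min_le_left η (1 / 2 : ℝ)]
  have hδ2 : δ < 1 / 2 := by linarith [min_le_right η (1 / 2 : ℝ)]
  have hL : 1 / 2 ≤ |Real.log δ| := by
    rw [abs_of_nonpos (Real.log_nonpos hδ.le (by linarith))]
    linarith [Real.log_le_sub_one_of_pos hδ]
  set L := |Real.log δ| with hLdef
  have hex : ∃ J : ℕ, ε ≤ 2 ^ J * δ := by
    obtain ⟨J, hJ⟩ := pow_unbounded_of_one_lt (ε / δ) (one_lt_two (α := ℝ))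
    exact ⟨J, ((div_lt_iff₀ hδ).1 hJ).le⟩
  classical
  obtain ⟨J, hJ, hJmin⟩ : ∃ J : ℕ, ε ≤ 2 ^ J * δ ∧ ∀ j < J, 2 ^ j * δ < ε :=
    ⟨Nat.find hex, Nat.find_spec hex, fun j hj => not_le.1 (Nat.find_min hex hj)⟩
  have hmass : ∀ᶠ R in (U : Filter ℝ), ∀ j ∈ Finset.range J,
      circleMass h R (Metric.closedBall θ (2 ^ j * δ)) ≤
        c / 56 * (2 ^ j * δ * |Real.log (2 ^ j * δ)|) := by
    refine (Filter.eventually_all_finset _).2 fun j hj => ?_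
    have := hcon (2 ^ j * δ) (by positivity) (hJmin j (Finset.mem_range.1 hj))
    exact this.mono fun R hR => hR.le
  have hlim : ∀ᶠ R in (U : Filter ℝ), c / 2 * L < h (circleMap 0 (R * (1 - δ)) θ) := by
    have hmem : circleMap 0 (1 - δ) θ ∈ Metric.ball (0 : ℂ) 1 :=
      circleMap_mem_unit_ball (by linarith) hr1 θ
    have hcont : ContinuousAt (fun R : ℝ => h (circleMap 0 (R * (1 - δ)) θ)) 1 := by
      refine ContinuousAt.comp (g := h) ?_ ?_
      · rw [one_mul]
        exact hh.continuousOn.continuousAt (Metric.isOpen_ball.mem_nhds hmem)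
      · unfold circleMap
        fun_prop
    have hlt : c / 2 * L < h (circleMap 0 (1 * (1 - δ)) θ) := by
      rw [one_mul]
      refine lt_of_lt_of_le ?_ hr
      have : 0 < c * L := by positivity
      linarith
    exact hU (mem_nhdsWithin_of_mem_nhds (hcont.eventually (lt_mem_nhds hlt)))
  have hR : ∀ᶠ R in (U : Filter ℝ), 0 < R ∧ R < 1 :=
    hU ((eventually_nhdsWithin_of_eventually_nhds (lt_mem_nhds one_pos)).and
      eventually_mem_nhdsWithin)
  obtain ⟨R, hm, hl, hR0, hR1⟩ := (hmass.and (hlim.and hR)).exists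
  have hmain := mul_le_sum_circleMass hh hpos hR0 hR1 hδ hδ2.le hθ J
  rw [← hTdef] at hmain
  have hsum : ∑ j ∈ Finset.range J,
      (1 / 4) ^ j * circleMass h R (Metric.closedBall θ (2 ^ j * δ)) ≤ c / 28 * (δ * L) := by
    calc _ ≤ ∑ j ∈ Finset.range J, (1 / 2) ^ j * (c / 56 * (δ * L)) := by
          refine Finset.sum_le_sum fun j hj => ?_
          have hjε := hJmin j (Finset.mem_range.1 hj)
          have hlog : |Real.log (2 ^ j * δ)| ≤ L := by
            have hge : δ ≤ 2 ^ j * δ := le_mul_of_one_le_left hδ.le (one_le_pow₀ one_le_two)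
            rw [hLdef, abs_of_nonpos (Real.log_nonpos (by positivity) (by linarith)),
              abs_of_nonpos (Real.log_nonpos hδ.le (by linarith))]
            linarith [Real.log_le_log hδ hge]
          calc _ ≤ (1 / 4) ^ j * (c / 56 * (2 ^ j * δ * L)) := by
                gcongr
                refine (hm j hj).trans ?_
                gcongr
            _ = ((1 / 4) ^ j * 2 ^ j) * (c / 56 * (δ * L)) := by ring
            _ = _ := by rw [← mul_pow]; norm_num
      _ = (∑ j ∈ Finset.range J, (1 / 2) ^ j) * (c / 56 * (δ * L)) := by rw [Finset.sum_mul]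
      _ ≤ 2 * (c / 56 * (δ * L)) := by
          gcongr
          exact sum_geometric_two_le J
      _ = _ := by ring
  have htail : (1 / 4) ^ J * T ≤ δ ^ 2 / ε ^ 2 * T := by
    gcongr
    rw [le_div_iff₀ (by positivity), one_div, inv_pow, inv_mul_le_iff₀ (by positivity)]
    calc ε ^ 2 ≤ (2 ^ J * δ) ^ 2 := by gcongr
      _ = 4 ^ J * δ ^ 2 := by rw [mul_pow, ← pow_mul, mul_comm J, pow_mul]; norm_num
  have h1 : c / 2 * L * δ < 7 * (c / 28 * (δ * L) + δ ^ 2 / ε ^ 2 * T) :=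
    (mul_lt_mul_of_pos_right hl hδ).trans_le (hmain.trans (by gcongr))
  have h2 : δ * (c / 4 * L) < δ * (7 * δ * T / ε ^ 2) := by
    calc _ < 7 * (δ ^ 2 / ε ^ 2 * T) := by linarith
      _ = _ := by ring
  have h3 := lt_of_mul_lt_mul_left h2 hδ.le
  have h4 : 7 * δ * T / ε ^ 2 ≤ 7 * η * T / ε ^ 2 := by gcongr
  nlinarith

end PositiveHarmonic

/-- If `f ∈ A^{-∞}` and `|f|` is bounded below by a positive constant, then `G_+(f)` is a
countable union of sets of finite `H_λ` measure, where `λ(t) = t |log t|`. -/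
theorem stmt6 (f : ℂ → ℂ) (hf : Korenblum f)
    (m : ℝ) (hm : 0 < m) (hlow : ∀ z ∈ Metric.ball (0:ℂ) 1, m ≤ ‖f z‖) :
    ∃ S : ℕ → Set ℝ, Gplus f = ⋃ n, S n ∧
      ∀ n, hausdorffGauge (fun t => t * |Real.log t|) (S n) < ⊤ := by
  have hfne : ∀ z ∈ Metric.ball (0 : ℂ) 1, f z ≠ 0 := fun z hz h0 => by
    have := hlow z hz
    rw [h0, norm_zero] at this
    linarith
  set h : ℂ → ℝ := fun z => Real.log ‖f z‖ - Real.log m with hdef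
  have hh : InnerProductSpace.HarmonicOnNhd h (Metric.ball 0 1) := fun z hz =>
    ((hf.1.analyticAt (Metric.isOpen_ball.mem_nhds hz)).harmonicAt_log_norm (hfne z hz)).sub
      (InnerProductSpace.harmonicAt_const _)
  have hpos : ∀ z ∈ Metric.ball (0 : ℂ) 1, 0 ≤ h z := fun z hz =>
    sub_nonneg.2 (Real.log_le_log hm (hlow z hz))
  set U : Ultrafilter ℝ := Ultrafilter.of (nhdsWithin 1 (Set.Iio 1))
  have hU : (U : Filter ℝ) ≤ nhdsWithin 1 (Set.Iio 1) := Ultrafilter.of_le _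
  have hR : ∀ᶠ R in (U : Filter ℝ), 0 < R ∧ R < 1 :=
    hU ((eventually_nhdsWithin_of_eventually_nhds (lt_mem_nhds one_pos)).and
      eventually_mem_nhdsWithin)
  refine ⟨fun n => {θ | θ ∈ Set.Ico 0 (2 * Real.pi) ∧ ∃ᶠ r : ℝ in nhdsWithin 1 (Set.Iio 1),
    1 / ((n : ℝ) + 1) ≤ Real.log ‖f ((r : ℂ) * Complex.exp (Complex.I * (θ : ℂ)))‖ /
      |Real.log (1 - r)|}, ?_, fun n => ?_⟩
  · ext θ
    simp only [Gplus, Set.mem_ofPred_eq, Set.mem_iUnion]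
    constructor
    · rintro ⟨hθ, c, hc, hfr⟩
      obtain ⟨n, hn⟩ := exists_nat_one_div_lt hc
      exact ⟨n, hθ, hfr.mono fun r hr => hn.le.trans hr⟩
    · rintro ⟨n, hθ, hfr⟩
      exact ⟨hθ, _, by positivity, hfr⟩
  · have hc : (0 : ℝ) < 1 / ((n : ℝ) + 1) / 2 := by positivity
    set c : ℝ := 1 / ((n : ℝ) + 1) / 2 with hcdef
    refine hausdorffGauge_lt_top_of_forall_exists_mass_le (U := U) (circleMass h)
      (c := c / 56) (T := 4 * Real.pi * h 0) (by positivity)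
      (hR.mono fun R hR s ρ hs => sum_circleMass_closedBall_le hh hpos hR.1 hR.2 s ρ hs) ?_
    rintro ε hε θ ⟨hθ, hfr⟩
    refine exists_circleMass_ge hh hpos U hU hc hθ ?_ hε
    have hlog : Tendsto (fun r : ℝ => |Real.log (1 - r)|) (nhdsWithin 1 (Set.Iio 1)) atTop := by
      refine tendsto_abs_atBot_atTop.comp (Real.tendsto_log_nhdsGT_zero.comp ?_)
      refine tendsto_nhdsWithin_iff.2 ⟨?_, ?_⟩
      · exact ((continuous_const.sub continuous_id).tendsto' (1 : ℝ) 0 (sub_self 1)).mono_left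
          nhdsWithin_le_nhds
      · filter_upwards [eventually_mem_nhdsWithin] with r hr
        exact sub_pos.2 (Set.mem_Iio.1 hr)
    have hev := (hlog.eventually_gt_atTop 0).and (hlog.eventually_ge_atTop (Real.log m / c))
    refine (hfr.and_eventually hev).mono ?_
    rintro r ⟨h1, h2, h3⟩
    rw [le_div_iff₀ h2] at h1
    rw [div_le_iff₀ hc] at h3
    have hcm : circleMap 0 r θ = (r : ℂ) * Complex.exp (Complex.I * (θ : ℂ)) := by
      rw [circleMap_zero, mul_comm Complex.I]
    simp only [hdef, hcm]
    rw [show 1 / ((n : ℝ) + 1) = 2 * c by rw [hcdef]; ring] at h1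
    linarith
end
end

section
/- For every function u in the class K, the set E_+(u) has Lebesgue measure zero. -/
open Filter MeasureTheory

noncomputable section

/-- `u` is harmonic on the open unit disc; on the (simply connected) disc this is
equivalent to `u` being the real part of a holomorphic function. -/
def HarmonicOnDisc (u : ℂ → ℝ) : Prop :=
  ∃ F : ℂ → ℂ, DifferentiableOn ℂ F (Metric.ball 0 1) ∧
    ∀ z ∈ Metric.ball (0:ℂ) 1, u z = (F z).re

/-- The class `K`: harmonic functions on the unit disc with
`u(z) ≤ C log(e/(1-|z|))`. -/
def ClassK (u : ℂ → ℝ) : Prop :=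
  HarmonicOnDisc u ∧
    ∃ C : ℝ, ∀ z ∈ Metric.ball (0:ℂ) 1, u z ≤ C * Real.log (Real.exp 1 / (1 - ‖z‖))

/-- `E_+(u)`: the set of `θ ∈ [0, 2π)` such that
`liminf_{r→1⁻} u(re^{iθ}) / |log(1-r)| > 0`. -/
def Eplus (u : ℂ → ℝ) : Set ℝ :=
  {θ | θ ∈ Set.Ico 0 (2 * Real.pi) ∧
    ∃ c : ℝ, 0 < c ∧ ∀ᶠ r : ℝ in nhdsWithin 1 (Set.Iio 1),
      c ≤ u ((r : ℂ) * Complex.exp (Complex.I * (θ : ℂ))) / |Real.log (1 - r)|}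

/-- The Poisson integral on the unit disc of the indicator function of `B`. -/
def harmonicMeasure (B : Set ℂ) (z : ℂ) : ℝ :=
  Real.circleAverage (poissonKernel 0 z • B.indicator 1) 0 1

section HarmonicMeasure

open Complex Metric Set Filter Topology

variable {B : Set ℂ} {z : ℂ}

lemma circleIntegrable_indicator_one (hB : MeasurableSet B) :
    CircleIntegrable (B.indicator (1 : ℂ → ℝ)) 0 1 := by
  refine (intervalIntegrable_const (c := (1 : ℝ))).mono_fun ?_ ?_
  · exact ((measurable_one.indicator hB).comp
      (continuous_circleMap 0 1).measurable).aestronglyMeasurable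
  · filter_upwards with t
    by_cases h : circleMap 0 1 t ∈ B <;> simp [h]

lemma exists_differentiableOn_re_eq_harmonicMeasure (hB : MeasurableSet B) :
    ∃ W : ℂ → ℂ, DifferentiableOn ℂ W (ball 0 1) ∧
      ∀ z ∈ ball (0 : ℂ) 1, (W z).re = harmonicMeasure B z := by
  have h := circleIntegrable_indicator_one hB
  refine ⟨_, differentiableOn_circleAverage_herglotzRieszKernel_smul
    (f := fun ζ ↦ ((B.indicator 1 ζ : ℝ) : ℂ)) ?_, fun z hz ↦ ?_⟩
  · simp only [CircleIntegrable, intervalIntegrable_iff] at h ⊢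
    exact Complex.ofRealCLM.integrable_comp h
  · rw [re_circleAverage_herglotzRieszKernel_smul h hz, harmonicMeasure,
      poissonKernel_eq_re_herglotzRieszKernel]

lemma harmonicMeasure_eq_integral_add (B : Set ℂ) (z : ℂ) (η : ℝ) :
    harmonicMeasure B z = (2 * Real.pi)⁻¹ * ∫ t in 0..2 * Real.pi,
      poissonKernel 0 z (circleMap 0 1 (t + η)) * B.indicator 1 (circleMap 0 1 (t + η)) :=
  Real.circleAverage_eq_integral_add η

lemma poissonKernel_circleMap (z : ℂ) (t : ℝ) :
    poissonKernel 0 z (circleMap 0 1 t) = (1 - ‖z‖ ^ 2) / ‖circleMap 0 1 t - z‖ ^ 2 := by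
  simp [poissonKernel_def]

lemma one_sub_norm_le_norm_circleMap_sub (z : ℂ) (t : ℝ) :
    1 - ‖z‖ ≤ ‖circleMap 0 1 t - z‖ := by
  simpa using norm_sub_norm_le (circleMap 0 1 t) z

lemma continuous_poissonKernel_circleMap (hz : ‖z‖ < 1) :
    Continuous fun t ↦ poissonKernel 0 z (circleMap 0 1 t) := by
  simp only [poissonKernel_circleMap]
  refine continuous_const.div (by fun_prop) fun t ↦ ?_
  have := one_sub_norm_le_norm_circleMap_sub z t
  have : 0 < ‖circleMap 0 1 t - z‖ := by linarith
  positivity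

lemma poissonKernel_circleMap_mul_indicator_nonneg (hz : ‖z‖ < 1) (B : Set ℂ) (t : ℝ) :
    0 ≤ poissonKernel 0 z (circleMap 0 1 t) * B.indicator 1 (circleMap 0 1 t) := by
  rw [poissonKernel_circleMap]
  have : 0 ≤ 1 - ‖z‖ ^ 2 := by nlinarith [norm_nonneg z]
  exact mul_nonneg (by positivity) (indicator_nonneg (by simp) _)

lemma harmonicMeasure_nonneg (hz : ‖z‖ < 1) : 0 ≤ harmonicMeasure B z := by
  rw [harmonicMeasure_eq_integral_add B z 0]
  refine mul_nonneg (by positivity) (intervalIntegral.integral_nonneg (by positivity) ?_)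
  exact fun t _ ↦ poissonKernel_circleMap_mul_indicator_nonneg hz B _

lemma intervalIntegrable_poissonKernel_mul_indicator (hB : MeasurableSet B) (hz : ‖z‖ < 1)
    (η a b : ℝ) :
    IntervalIntegrable (fun t ↦ poissonKernel 0 z (circleMap 0 1 (t + η)) *
      B.indicator 1 (circleMap 0 1 (t + η))) volume a b := by
  have hc := (continuous_poissonKernel_circleMap hz).comp (continuous_add_const η)
  refine (hc.intervalIntegrable a b).mono_fun ?_ ?_
  · exact (hc.measurable.mul ((measurable_one.indicator hB).comp
      ((continuous_circleMap 0 1).comp (continuous_add_const η)).measurable)).aestronglyMeasurable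
  · filter_upwards with t
    by_cases h : circleMap 0 1 (t + η) ∈ B <;> simp [h]

lemma norm_circleMap_add_sub_circleMap_le (φ : ℝ) {t : ℝ} (ht : 0 ≤ t) :
    ‖circleMap 0 1 (t + φ) - circleMap 0 1 φ‖ ≤ t := by
  have e : circleMap 0 1 (t + φ) - circleMap 0 1 φ = circleMap 0 1 φ * (exp (I * t) - 1) := by
    simp only [circleMap, ofReal_add, add_mul, exp_add]
    push_cast; rw [mul_comm I]; ring
  have := Real.norm_exp_I_mul_ofReal_sub_one_le (x := t)
  rw [e, norm_mul, norm_circleMap_zero]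
  simpa [abs_of_nonneg ht] using this

/-- If `B` contains an arc of length `s (1 - r)` starting at `e^{iφ}`, its harmonic measure
seen from `r e^{iφ}` is bounded below. -/
lemma le_harmonicMeasure_of_arc {r s φ : ℝ} (hB : MeasurableSet B) (hr0 : 0 ≤ r) (hr : r < 1)
    (hs0 : 0 ≤ s) (hs : s ≤ 1) (h : ∀ t ∈ Icc 0 (s * (1 - r)), circleMap 0 1 (t + φ) ∈ B) :
    s / (8 * Real.pi) ≤ harmonicMeasure B (circleMap 0 r φ) := by
  set z := circleMap 0 r φ with hz
  have hzr : ‖z‖ = r := by simp [hz, abs_of_nonneg hr0]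
  have hz1 : ‖z‖ < 1 := by linarith
  have h0 : 0 ≤ s * (1 - r) := mul_nonneg hs0 (by linarith)
  have hpi : s * (1 - r) ≤ 2 * Real.pi := by nlinarith [Real.pi_gt_three]
  have key : ∀ t ∈ Icc 0 (s * (1 - r)), (4 * (1 - r))⁻¹ ≤
      poissonKernel 0 z (circleMap 0 1 (t + φ)) * B.indicator 1 (circleMap 0 1 (t + φ)) := by
    intro t ht
    rw [poissonKernel_circleMap, indicator_of_mem (h t ht), Pi.one_apply, mul_one, hzr]
    have h1 := norm_circleMap_add_sub_circleMap_le φ ht.1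
    have h2 : ‖circleMap 0 1 φ - z‖ = 1 - r := by
      have e : circleMap 0 1 φ - z = circleMap 0 (1 - r) φ := by
        simp only [hz, circleMap]; push_cast; ring
      rw [e, norm_circleMap_zero, abs_of_pos (by linarith)]
    have h3 : ‖circleMap 0 1 (t + φ) - z‖ ≤ 2 * (1 - r) := by
      have := norm_sub_le_norm_sub_add_norm_sub (circleMap 0 1 (t + φ)) (circleMap 0 1 φ) z
      nlinarith [ht.2]
    have h4 : 0 < ‖circleMap 0 1 (t + φ) - z‖ := by
      have := one_sub_norm_le_norm_circleMap_sub z (t + φ); linarith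
    rw [inv_eq_one_div, div_le_div_iff₀ (by linarith) (by positivity)]
    have : ‖circleMap 0 1 (t + φ) - z‖ ^ 2 ≤ (2 * (1 - r)) ^ 2 := by gcongr
    nlinarith [mul_nonneg hr0 (sq_nonneg (1 - r))]
  rw [harmonicMeasure_eq_integral_add B z φ]
  have hle : s / 4 ≤ ∫ t in 0..2 * Real.pi, poissonKernel 0 z (circleMap 0 1 (t + φ)) *
      B.indicator 1 (circleMap 0 1 (t + φ)) := by
    calc s / 4 = ∫ t in 0..s * (1 - r), (4 * (1 - r))⁻¹ := by
          have : 1 - r ≠ 0 := by linarith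
          rw [intervalIntegral.integral_const, smul_eq_mul]; field_simp; ring
      _ ≤ ∫ t in 0..s * (1 - r), poissonKernel 0 z (circleMap 0 1 (t + φ)) *
            B.indicator 1 (circleMap 0 1 (t + φ)) :=
          intervalIntegral.integral_mono_on h0 (by simp)
            (intervalIntegrable_poissonKernel_mul_indicator hB hz1 _ _ _) key
      _ ≤ _ := by
          refine intervalIntegral.integral_mono_interval le_rfl h0 hpi ?_
            (intervalIntegrable_poissonKernel_mul_indicator hB hz1 _ _ _)
          filter_upwards with t
          exact poissonKernel_circleMap_mul_indicator_nonneg hz1 B _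
  calc s / (8 * Real.pi) = (2 * Real.pi)⁻¹ * (s / 4) := by field_simp; ring
    _ ≤ _ := by gcongr

lemma norm_circleMap_add_sub_sq (r θ s : ℝ) :
    ‖circleMap 0 1 (s + θ) - circleMap 0 r θ‖ ^ 2 = (1 - r) ^ 2 + 2 * r * (1 - Real.cos s) := by
  have e : circleMap 0 1 (s + θ) - circleMap 0 r θ
      = circleMap 0 1 θ * (circleMap 0 1 s - r) := by
    simp only [circleMap, ofReal_add, add_mul, exp_add]
    push_cast; ring
  rw [e, norm_mul, norm_circleMap_zero, abs_one, one_mul, ← Complex.normSq_eq_norm_sq,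
    Complex.normSq_apply]
  simp [circleMap, exp_ofReal_mul_I_re, exp_ofReal_mul_I_im]
  nlinarith [Real.sin_sq_add_cos_sq s]

lemma poissonKernel_circleMap_le_div_sq {r s θ : ℝ} (hr0 : 1 / 2 ≤ r) (hr : r < 1) (hs0 : s ≠ 0)
    (hs : |s| ≤ Real.pi) :
    poissonKernel 0 (circleMap 0 r θ) (circleMap 0 1 (s + θ)) ≤
      Real.pi ^ 2 * (1 - r) / s ^ 2 := by
  have hcos := Real.cos_le_one_sub_mul_cos_sq hs
  rw [poissonKernel_circleMap, norm_circleMap_add_sub_sq, norm_circleMap_zero, sq_abs]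
  have hpi := Real.pi_pos
  have hs2 : 0 < s ^ 2 := by positivity
  have h1 : 2 / Real.pi ^ 2 * s ^ 2 ≤ (1 - r) ^ 2 + 2 * r * (1 - Real.cos s) := by
    have h2 : 2 / Real.pi ^ 2 * s ^ 2 ≤ 1 - Real.cos s := by linarith
    have h3 : 0 ≤ 2 / Real.pi ^ 2 * s ^ 2 := by positivity
    nlinarith [sq_nonneg (1 - r)]
  calc (1 - r ^ 2) / ((1 - r) ^ 2 + 2 * r * (1 - Real.cos s))
      ≤ (2 * (1 - r)) / (2 / Real.pi ^ 2 * s ^ 2) := by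
        gcongr
        nlinarith [sq_nonneg (1 - r)]
    _ = _ := by field_simp

lemma poissonKernel_circleMap_le {z : ℂ} (hz : ‖z‖ < 1) (t : ℝ) :
    poissonKernel 0 z (circleMap 0 1 t) ≤ 2 / (1 - ‖z‖) := by
  have h := one_sub_norm_le_norm_circleMap_sub z t
  have h0 : 0 < 1 - ‖z‖ := by linarith
  rw [poissonKernel_circleMap]
  calc (1 - ‖z‖ ^ 2) / ‖circleMap 0 1 t - z‖ ^ 2 ≤ (2 * (1 - ‖z‖)) / (1 - ‖z‖) ^ 2 := by
        gcongr
        nlinarith [norm_nonneg z]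
    _ = _ := by field_simp

lemma integral_const_div_sq_add_sq_le {c : ℝ} (hc : 0 < c) (a b : ℝ) :
    ∫ x in a..b, (x ^ 2 + c ^ 2)⁻¹ ≤ Real.pi / c := by
  have e : ∀ x : ℝ, (x ^ 2 + c ^ 2)⁻¹ = (c ^ 2)⁻¹ * (1 + (x / c) ^ 2)⁻¹ := by
    intro x; rw [← mul_inv]; congr 1; field_simp; ring
  simp_rw [e]
  rw [intervalIntegral.integral_const_mul,
    intervalIntegral.integral_comp_div (fun x ↦ (1 + x ^ 2)⁻¹) hc.ne', integral_inv_one_add_sq]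
  have h1 := Real.arctan_lt_pi_div_two (b / c)
  have h2 := Real.neg_pi_div_two_lt_arctan (a / c)
  rw [smul_eq_mul, ← mul_assoc]
  calc _ ≤ (c ^ 2)⁻¹ * c * Real.pi := by gcongr; linarith
    _ = _ := by field_simp

lemma harmonicMeasure_le {r c θ : ℝ} (hB : MeasurableSet B) (hr0 : 1 / 2 ≤ r) (hr : r < 1)
    (hc : 0 < c) :
    harmonicMeasure B (circleMap 0 r θ) ≤ (2 * Real.pi)⁻¹ *
      (2 / (1 - r) * volume.real (circleMap 0 1 ⁻¹' B ∩ closedBall θ c)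
        + 2 * Real.pi ^ 3 * (1 - r) / c) := by
  set z := circleMap 0 r θ with hz
  have hzr : ‖z‖ = r := by simp [hz, abs_of_nonneg (by linarith : 0 ≤ r)]
  have hz1 : ‖z‖ < 1 := by linarith
  have hr1 : 0 < 1 - r := by linarith
  have hpi := Real.pi_pos
  set A : Set ℝ := (fun s ↦ s + θ) ⁻¹' (circleMap 0 1 ⁻¹' B ∩ closedBall θ c) with hA
  have hAm : MeasurableSet A := by
    refine (((continuous_circleMap 0 1).measurable hB).inter measurableSet_closedBall).preimage ?_
    fun_prop
  have hAv : volume.real A = volume.real (circleMap 0 1 ⁻¹' B ∩ closedBall θ c) := by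
    simp only [measureReal_def, hA, measure_preimage_add_right]
  have hAfin : volume A ≠ ⊤ := by
    rw [hA, measure_preimage_add_right]
    exact measure_ne_top_of_subset inter_subset_right measure_closedBall_lt_top.ne
  have hbd : ∀ s ∈ Icc (-Real.pi) Real.pi,
      poissonKernel 0 z (circleMap 0 1 (s + θ)) * B.indicator 1 (circleMap 0 1 (s + θ)) ≤
        A.indicator (fun _ ↦ 2 / (1 - r)) s + 2 * Real.pi ^ 2 * (1 - r) * (s ^ 2 + c ^ 2)⁻¹ := by
    intro s hs
    have h2 : 0 ≤ 2 * Real.pi ^ 2 * (1 - r) * (s ^ 2 + c ^ 2)⁻¹ := by positivity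
    have h3 : 0 ≤ A.indicator (fun _ ↦ 2 / (1 - r)) s :=
      indicator_nonneg (fun _ _ ↦ by positivity) _
    by_cases hsB : circleMap 0 1 (s + θ) ∈ B
    · rw [indicator_of_mem hsB, Pi.one_apply, mul_one]
      by_cases hsc : |s| ≤ c
      · have : s ∈ A := ⟨hsB, by simpa [Real.dist_eq] using hsc⟩
        have h4 := poissonKernel_circleMap_le hz1 (s + θ)
        rw [hzr] at h4
        rw [indicator_of_mem this]
        linarith
      · push Not at hsc
        have hs0 : s ≠ 0 := by rintro rfl; simp at hsc; linarith
        have h4 := poissonKernel_circleMap_le_div_sq (θ := θ) hr0 hr hs0 (abs_le.2 hs)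
        have h5 : c ^ 2 ≤ s ^ 2 := by rw [← sq_abs s]; gcongr
        have h6 : Real.pi ^ 2 * (1 - r) / s ^ 2
            ≤ 2 * Real.pi ^ 2 * (1 - r) * (s ^ 2 + c ^ 2)⁻¹ := by
          rw [← div_eq_mul_inv, div_le_div_iff₀ (by positivity) (by positivity)]
          have : 0 ≤ Real.pi ^ 2 * (1 - r) := by positivity
          nlinarith
        linarith
    · rw [indicator_of_notMem hsB, mul_zero]
      positivity
  have hint1 : IntegrableOn (A.indicator fun _ ↦ 2 / (1 - r)) univ volume := by
    rw [integrableOn_univ]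
    exact (integrableOn_const hAfin).integrable_indicator hAm
  have hI1 : IntervalIntegrable (A.indicator fun _ ↦ 2 / (1 - r)) volume (-Real.pi) Real.pi :=
    intervalIntegrable_iff.2 (hint1.mono_set (subset_univ _))
  have hI2 : IntervalIntegrable (fun s : ℝ ↦ 2 * Real.pi ^ 2 * (1 - r) * (s ^ 2 + c ^ 2)⁻¹)
      volume (-Real.pi) Real.pi := by
    refine Continuous.intervalIntegrable ?_ _ _
    refine continuous_const.mul (Continuous.inv₀ (by fun_prop) fun x ↦ by positivity)
  have hfirst : ∫ s in -Real.pi..Real.pi, A.indicator (fun _ ↦ 2 / (1 - r)) s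
      ≤ 2 / (1 - r) * volume.real A := by
    rw [intervalIntegral.integral_of_le (by linarith)]
    calc _ ≤ ∫ s, A.indicator (fun _ ↦ 2 / (1 - r)) s :=
          setIntegral_le_integral (integrableOn_univ.1 hint1)
            (Eventually.of_forall (indicator_nonneg (fun _ _ ↦ by positivity)))
      _ = _ := by rw [integral_indicator hAm, setIntegral_const, smul_eq_mul, mul_comm]
  have hsecond : ∫ s in -Real.pi..Real.pi, 2 * Real.pi ^ 2 * (1 - r) * (s ^ 2 + c ^ 2)⁻¹
      ≤ 2 * Real.pi ^ 3 * (1 - r) / c := by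
    rw [intervalIntegral.integral_const_mul]
    calc _ ≤ 2 * Real.pi ^ 2 * (1 - r) * (Real.pi / c) := by
          gcongr; exact integral_const_div_sq_add_sq_le hc _ _
      _ = _ := by ring
  have hshift : ∫ t in 0..2 * Real.pi, poissonKernel 0 z (circleMap 0 1 (t + (θ - Real.pi))) *
        B.indicator 1 (circleMap 0 1 (t + (θ - Real.pi))) =
      ∫ s in -Real.pi..Real.pi, poissonKernel 0 z (circleMap 0 1 (s + θ)) *
        B.indicator 1 (circleMap 0 1 (s + θ)) := by
    have := intervalIntegral.integral_comp_sub_right (a := 0) (b := 2 * Real.pi)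
      (fun s ↦ poissonKernel 0 z (circleMap 0 1 (s + θ)) *
        B.indicator 1 (circleMap 0 1 (s + θ))) Real.pi
    convert this using 3 <;> ring_nf
  rw [harmonicMeasure_eq_integral_add B z (θ - Real.pi), hshift, ← hAv]
  gcongr
  calc _ ≤ _ := intervalIntegral.integral_mono_on (by linarith)
        (intervalIntegrable_poissonKernel_mul_indicator hB hz1 _ _ _) (hI1.add hI2) hbd
    _ = _ := intervalIntegral.integral_add hI1 hI2
    _ ≤ _ := add_le_add hfirst hsecond

/-- At a point of zero density of `B`, the harmonic measure of `B` takes arbitrarily small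
values. -/
lemma exists_harmonicMeasure_lt (hB : MeasurableSet B) {θ κ : ℝ} (hκ : 0 < κ)
    (h : Tendsto (fun δ ↦ volume (circleMap 0 1 ⁻¹' B ∩ closedBall θ δ) / volume (closedBall θ δ))
      (𝓝[>] 0) (𝓝 0)) :
    ∃ z ∈ ball (0 : ℂ) 1, harmonicMeasure B z < κ := by
  have hpi := Real.pi_pos
  obtain ⟨N, hN⟩ := exists_gt (max 1 (2 * Real.pi ^ 2 / κ))
  have hN1 : 1 < N := (le_max_left _ _).trans_lt hN
  have hN2 : Real.pi ^ 2 / N < κ / 2 := by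
    have := (le_max_right _ _).trans_lt hN
    rw [div_lt_iff₀ hκ] at this
    rw [div_lt_div_iff₀ (by linarith) two_pos]
    linarith
  have hreal : Tendsto (fun δ ↦ volume.real (circleMap 0 1 ⁻¹' B ∩ closedBall θ δ) / (2 * δ))
      (𝓝[>] 0) (𝓝 0) := by
    have := (ENNReal.tendsto_toReal ENNReal.zero_ne_top).comp h
    refine this.congr' ?_
    filter_upwards [self_mem_nhdsWithin] with δ hδ
    simp [ENNReal.toReal_div, measureReal_def, Real.volume_closedBall, (mem_Ioi.1 hδ).le]
  have hpos : 0 < Real.pi * κ / (4 * N) := by positivity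
  have hev : ∀ᶠ δ in 𝓝[>] (0 : ℝ), δ ≤ 1 / 2 ∧ 0 < δ ∧
      volume.real (circleMap 0 1 ⁻¹' B ∩ closedBall θ δ) / (2 * δ) < Real.pi * κ / (4 * N) := by
    filter_upwards [self_mem_nhdsWithin, nhdsWithin_le_nhds (Iic_mem_nhds one_half_pos),
      hreal.eventually_lt_const hpos] with δ h1 h2 h3
    exact ⟨h2, h1, h3⟩
  obtain ⟨δ, hδ, hδ0, hlt⟩ := hev.exists
  have hΔ : δ / N ≤ 1 / 2 := (div_le_self hδ0.le hN1.le).trans hδ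
  have hΔ0 : 0 < δ / N := by positivity
  refine ⟨circleMap 0 (1 - δ / N) θ, ?_, ?_⟩
  · rw [mem_ball_zero_iff, norm_circleMap_zero, abs_lt]
    constructor <;> linarith
  · refine (harmonicMeasure_le hB (by linarith) (by linarith) hδ0).trans_lt ?_
    rw [sub_sub_cancel]
    rw [div_lt_iff₀ (by positivity)] at hlt
    set V := volume.real (circleMap 0 1 ⁻¹' B ∩ closedBall θ δ)
    have e : (2 * Real.pi)⁻¹ * (2 / (δ / N) * V + 2 * Real.pi ^ 3 * (δ / N) / δ)
        = N / (Real.pi * δ) * V + Real.pi ^ 2 / N := by field_simp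
    have h1 : N / (Real.pi * δ) * V < N / (Real.pi * δ) * (Real.pi * κ / (4 * N) * (2 * δ)) := by
      gcongr
    have h2 : N / (Real.pi * δ) * (Real.pi * κ / (4 * N) * (2 * δ)) = κ / 2 := by
      field_simp; ring
    rw [e]
    linarith

end HarmonicMeasure

section RadialGrowth

open Complex Metric Set Filter Topology

variable {F W : ℂ → ℂ}

/-- The points `ζ` of the unit circle with `Re F (r ζ) ≥ c log (1 / (1 - r))` for
`r₀ ≤ r < 1`. -/
def radialGrowthSet (F : ℂ → ℂ) (c r₀ : ℝ) : Set ℂ :=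
  {ζ | ‖ζ‖ = 1 ∧ ∀ r ∈ Ico r₀ 1, c * -Real.log (1 - r) ≤ (F (r * ζ)).re}

lemma isClosed_radialGrowthSet (hF : DifferentiableOn ℂ F (ball 0 1)) (c : ℝ) {r₀ : ℝ}
    (hr₀ : 0 ≤ r₀) : IsClosed (radialGrowthSet F c r₀) := by
  have e : radialGrowthSet F c r₀ = sphere 0 1 ∩ ⋂ r ∈ Ico r₀ 1,
      (sphere 0 1 ∩ (fun ζ : ℂ ↦ (F (r * ζ)).re) ⁻¹' Ici (c * -Real.log (1 - r))) := by
    ext ζ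
    simp only [radialGrowthSet, mem_ofPred_eq, mem_inter_iff, mem_iInter, mem_sphere_iff_norm,
      sub_zero, mem_preimage, mem_Ici]
    grind
  rw [e]
  refine isClosed_sphere.inter (isClosed_biInter fun r hr ↦ ?_)
  refine ContinuousOn.preimage_isClosed_of_isClosed ?_ isClosed_sphere isClosed_Ici
  refine Complex.continuous_re.comp_continuousOn (hF.continuousOn.comp (by fun_prop) ?_)
  intro ζ hζ
  rw [mem_sphere_iff_norm, sub_zero] at hζ
  rw [mem_ball_zero_iff, norm_mul, hζ, mul_one, Complex.norm_real, Real.norm_eq_abs,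
    abs_of_nonneg (hr₀.trans hr.1)]
  exact hr.2

/-- A Harnack type estimate: logarithmic growth from above prevents `Re F` from dropping much
in a small pseudohyperbolic disc. -/
lemma re_sub_le_re_of_norm_sub_le {C a r : ℝ} {p z : ℂ} (hF : DifferentiableOn ℂ F (ball 0 1))
    (hC : 0 < C)
    (hFC : ∀ z ∈ ball (0 : ℂ) 1, (F z).re ≤ C * Real.log (Real.exp 1 / (1 - ‖z‖)))
    (hr0 : 0 ≤ r) (hr : r < 1) (hp : ‖p‖ = r) (hp0 : 0 ≤ (F p).re)
    (ha0 : 0 ≤ a) (ha : a ≤ 1 / 4) (hz : ‖z - p‖ ≤ a * (1 - r)) :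
    (F p).re - 8 * a * C * (2 - Real.log (1 - r)) ≤ (F z).re := by
  have hr1 : 0 < 1 - r := by linarith
  have hlog : Real.log (1 - r) ≤ 0 := Real.log_nonpos hr1.le (by linarith)
  have hsub : ∀ ξ ∈ ball (0 : ℂ) ((1 - r) / 2), ‖p + ξ‖ ≤ 1 - (1 - r) / 2 := by
    intro ξ hξ
    have := norm_add_le p ξ
    rw [mem_ball_zero_iff] at hξ
    linarith
  have hmaps : MapsTo (fun ξ ↦ p + ξ) (ball (0 : ℂ) ((1 - r) / 2)) (ball 0 1) := by
    intro ξ hξ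
    have := hsub ξ hξ
    rw [mem_ball_zero_iff]
    linarith
  have hd : DifferentiableOn ℂ (fun ξ ↦ F (p + ξ) - F p) (ball 0 ((1 - r) / 2)) :=
    (hF.comp (by fun_prop) hmaps).sub_const _
  have hM : 0 < C * (2 - Real.log (1 - r)) := mul_pos hC (by linarith)
  have hle : MapsTo (fun ξ ↦ F (p + ξ) - F p) (ball 0 ((1 - r) / 2))
      {w | w.re ≤ C * (2 - Real.log (1 - r))} := by
    intro ξ hξ
    have h1 := hFC _ (hmaps hξ)
    have h2 := hsub ξ hξ
    have h3 : Real.log (Real.exp 1 / (1 - ‖p + ξ‖)) ≤ 2 - Real.log (1 - r) := by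
      rw [Real.log_div (Real.exp_ne_zero _) (by linarith), Real.log_exp]
      have h4 : Real.log ((1 - r) / 2) ≤ Real.log (1 - ‖p + ξ‖) :=
        Real.log_le_log (by linarith) (by linarith)
      rw [Real.log_div hr1.ne' two_ne_zero] at h4
      linarith [Real.log_two_lt_d9]
    have h5 := mul_le_mul_of_nonneg_left h3 hC.le
    simp only [mem_ofPred_eq, sub_re]
    linarith
  have hzb : ‖z - p‖ ≤ (1 - r) / 4 := hz.trans (by nlinarith)
  have key := borelCaratheodory_zero (z := z - p) hM hd hle (by linarith)
    (by rw [mem_ball_zero_iff]; linarith) (by simp)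
  simp only [add_sub_cancel] at key
  have h6 : 2 * (C * (2 - Real.log (1 - r))) * ‖z - p‖ / ((1 - r) / 2 - ‖z - p‖)
      ≤ 8 * a * C * (2 - Real.log (1 - r)) := by
    rw [div_le_iff₀ (by linarith)]
    calc 2 * (C * (2 - Real.log (1 - r))) * ‖z - p‖
        ≤ 2 * (C * (2 - Real.log (1 - r))) * (a * (1 - r)) := by gcongr
      _ = 8 * a * C * (2 - Real.log (1 - r)) * ((1 - r) / 4) := by ring
      _ ≤ _ := by
        have : 0 ≤ 8 * a * C * (2 - Real.log (1 - r)) :=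
          mul_nonneg (by positivity) (by linarith)
        gcongr
        linarith
  have h7 := (abs_re_le_norm (F z - F p)).trans (key.trans h6)
  rw [sub_re, abs_le] at h7
  linarith

/-- A maximum principle on the part of a disc where a comparison function is small. -/
lemma le_re_add_of_frontier {A κ m r : ℝ} {z₀ : ℂ} (hF : DifferentiableOn ℂ F (ball 0 1))
    (hW : DifferentiableOn ℂ W (ball 0 1)) (hW0 : ∀ z ∈ ball (0 : ℂ) 1, 0 ≤ (W z).re)
    (hκ : 0 < κ) (hm : 0 ≤ m) (hr : r < 1)
    (hA : ∀ z ∈ ball (0 : ℂ) 1, (W z).re ≤ κ → 0 ≤ (F z).re + A)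
    (hmA : ∀ z : ℂ, ‖z‖ = r → (W z).re ≤ κ → m ≤ (F z).re + A)
    (hz₀ : ‖z₀‖ < r) (hWz₀ : (W z₀).re < κ) :
    m * (1 - (W z₀).re / κ) ≤ (F z₀).re + A := by
  have hsub : closedBall (0 : ℂ) r ⊆ ball 0 1 := closedBall_subset_ball hr
  set V : Set ℂ := {z | (W z).re < κ}
  set U : Set ℂ := ball 0 r ∩ V with hU
  have hUr : closure U ⊆ closedBall 0 r :=
    closure_minimal (inter_subset_left.trans ball_subset_closedBall) isClosed_closedBall
  have hcW : ContinuousOn (fun z ↦ (W z).re) (closedBall 0 r) :=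
    Complex.continuous_re.comp_continuousOn (hW.continuousOn.mono hsub)
  have hopen : IsOpen U :=
    (hcW.mono ball_subset_closedBall).isOpen_inter_preimage isOpen_ball (isOpen_Iio (a := κ))
  have hclV : ∀ z ∈ closure U, (W z).re ≤ κ := by
    have hc : IsClosed (closedBall 0 r ∩ (fun z ↦ (W z).re) ⁻¹' Iic κ) :=
      hcW.preimage_isClosed_of_isClosed isClosed_closedBall isClosed_Iic
    have : closure U ⊆ closedBall 0 r ∩ (fun z ↦ (W z).re) ⁻¹' Iic κ :=
      closure_minimal (fun z hz ↦
        ⟨ball_subset_closedBall hz.1, le_of_lt (show (W z).re < κ from hz.2)⟩) hc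
    exact fun z hz ↦ (this hz).2
  set G : ℂ → ℂ := fun z ↦ exp (m * (1 - W z / κ) - F z - A) with hG
  have hGn : ∀ z, ‖G z‖ = Real.exp (m * (1 - (W z).re / κ) - (F z).re - A) := by
    intro z
    simp [hG, Complex.norm_exp, Complex.div_ofReal_re]
  have hGd : DiffContOnCl ℂ G U := by
    refine DifferentiableOn.diffContOnCl ?_
    have h1 := hW.mono (hUr.trans hsub)
    have h2 := hF.mono (hUr.trans hsub)
    fun_prop
  have hfr : ∀ z ∈ frontier U, ‖G z‖ ≤ 1 := by
    intro z hz
    rw [hGn, Real.exp_le_one_iff]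
    have hzc := frontier_subset_closure hz
    have hzb := hsub (hUr hzc)
    have hWκ := hclV z hzc
    by_cases hzr : ‖z‖ = r
    · have h1 := hmA z hzr hWκ
      have h2 : 0 ≤ (W z).re / κ := div_nonneg (hW0 z hzb) hκ.le
      nlinarith
    · have hzlt : ‖z‖ < r := lt_of_le_of_ne (by simpa using hUr hzc) hzr
      have hzU : z ∉ U := fun h ↦ hz.2 (hopen.interior_eq.symm ▸ h)
      have : (W z).re = κ := by
        refine le_antisymm hWκ (not_lt.1 fun h ↦ hzU ⟨by simpa using hzlt, h⟩)
      rw [this, div_self hκ.ne']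
      linarith [hA z hzb hWκ]
  have hbdd : Bornology.IsBounded U := isBounded_ball.subset inter_subset_left
  have hzU : z₀ ∈ U := ⟨by simpa using hz₀, hWz₀⟩
  have := norm_le_of_forall_mem_frontier_norm_le hbdd hGd hfr (subset_closure hzU)
  rw [hGn, Real.exp_le_one_iff] at this
  linarith

lemma volume_preimage_radialGrowthSet {C c r₀ : ℝ} (hF : DifferentiableOn ℂ F (ball 0 1))
    (hC : 0 < C)
    (hFC : ∀ z ∈ ball (0 : ℂ) 1, (F z).re ≤ C * Real.log (Real.exp 1 / (1 - ‖z‖)))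
    (hc : 0 < c) (hr₀ : 0 ≤ r₀) (hr₀1 : r₀ < 1) :
    volume (circleMap 0 1 ⁻¹' radialGrowthSet F c r₀) = 0 := by
  by_contra hvol
  set T := radialGrowthSet F c r₀ with hT
  have hpi := Real.pi_pos
  have hTm : MeasurableSet T := (isClosed_radialGrowthSet hF c hr₀).measurableSet
  have hSm : MeasurableSet (circleMap 0 1 ⁻¹' Tᶜ) :=
    (continuous_circleMap 0 1).measurable hTm.compl
  obtain ⟨θ, hθT, hθ⟩ := ((frequently_ae_mem_iff.2 hvol).and_eventually
    (Besicovitch.ae_tendsto_measure_inter_div_of_measurableSet volume hSm)).exists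
  rw [indicator_of_notMem (by simpa using hθT)] at hθ
  set a := min (1 / 4) (c / (16 * C)) with ha
  have ha0 : 0 < a := lt_min (by norm_num) (by positivity)
  have ha4 : a ≤ 1 / 4 := min_le_left _ _
  have haC : 16 * a * C ≤ c := by
    have : a ≤ c / (16 * C) := min_le_right _ _
    rw [le_div_iff₀ (by positivity)] at this
    linarith
  set κ := a / (16 * Real.pi) with hκdef
  have hκ : 0 < κ := by positivity
  have hκlt : κ < a / (8 * Real.pi) := by
    rw [hκdef]; gcongr; norm_num
  obtain ⟨z₀, hz₀, hz₀κ⟩ := exists_harmonicMeasure_lt hTm.compl hκ hθ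
  obtain ⟨W, hW, hWre⟩ := exists_differentiableOn_re_eq_harmonicMeasure hTm.compl
  have hW0 : ∀ z ∈ ball (0 : ℂ) 1, 0 ≤ (W z).re := fun z hz ↦ by
    rw [hWre z hz]; exact harmonicMeasure_nonneg (by simpa using hz)
  have hgrowth : ∀ z ∈ ball (0 : ℂ) 1, r₀ ≤ ‖z‖ → (W z).re ≤ κ →
      c / 2 * -Real.log (1 - ‖z‖) - c ≤ (F z).re := by
    intro z hz hzr hWz
    rw [hWre z hz] at hWz
    rw [mem_ball_zero_iff] at hz
    have hlog : Real.log (1 - ‖z‖) ≤ 0 :=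
      Real.log_nonpos (by linarith) (by linarith [norm_nonneg z])
    have hzc : circleMap 0 ‖z‖ z.arg = z := by
      rw [circleMap_zero, norm_mul_exp_arg_mul_I]
    obtain ⟨t, ht, htT⟩ : ∃ t ∈ Icc 0 (a * (1 - ‖z‖)), circleMap 0 1 (t + z.arg) ∈ T := by
      by_contra! hcon
      have := le_harmonicMeasure_of_arc hTm.compl (norm_nonneg z) hz ha0.le (by linarith) hcon
      rw [hzc] at this
      linarith
    have hp := htT.2 ‖z‖ ⟨hzr, hz⟩
    have hp0 : 0 ≤ c * -Real.log (1 - ‖z‖) := mul_nonneg hc.le (by linarith)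
    have hdist : ‖z - ‖z‖ * circleMap 0 1 (t + z.arg)‖ ≤ a * (1 - ‖z‖) := by
      have h1 := norm_circleMap_add_sub_circleMap_le z.arg ht.1
      have h2 : z - ‖z‖ * circleMap 0 1 (t + z.arg)
          = -(‖z‖ * (circleMap 0 1 (t + z.arg) - circleMap 0 1 z.arg)) := by
        have h3 : (‖z‖ : ℂ) * circleMap 0 1 z.arg = z := by
          rw [circleMap_zero, ofReal_one, one_mul, norm_mul_exp_arg_mul_I]
        rw [mul_sub, h3]
        ring
      rw [h2, norm_neg, norm_mul, norm_real, norm_norm]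
      calc _ ≤ 1 * t := by gcongr
        _ ≤ _ := by linarith [ht.2]
    have hnp : ‖(‖z‖ * circleMap 0 1 (t + z.arg) : ℂ)‖ = ‖z‖ := by
      simp
    have := re_sub_le_re_of_norm_sub_le hF hC hFC (norm_nonneg z) hz hnp (hp0.trans hp) ha0.le ha4
      hdist
    nlinarith
  obtain ⟨A₀, hA₀⟩ := (isCompact_closedBall (0 : ℂ) r₀).exists_bound_of_continuousOn
    (hF.continuousOn.mono (closedBall_subset_ball hr₀1))
  set A := max A₀ c
  have hAc : c ≤ A := le_max_right _ _
  have hlow : ∀ z ∈ ball (0 : ℂ) 1, (W z).re ≤ κ → 0 ≤ (F z).re + A := by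
    intro z hz hWz
    rcases le_or_gt r₀ ‖z‖ with h | h
    · have h1 := hgrowth z hz h hWz
      rw [mem_ball_zero_iff] at hz
      have hlog : Real.log (1 - ‖z‖) ≤ 0 :=
        Real.log_nonpos (by linarith) (by linarith [norm_nonneg z])
      nlinarith
    · have h1 := (abs_re_le_norm (F z)).trans (hA₀ z (by simpa using h.le))
      have h2 : A₀ ≤ A := le_max_left _ _
      linarith [(abs_le.1 h1).1]
  rw [mem_ball_zero_iff] at hz₀
  have hineq : ∀ r, r₀ ≤ r → ‖z₀‖ < r → r < 1 →
      c / 2 * -Real.log (1 - r) * (1 - (W z₀).re / κ) ≤ (F z₀).re + A := by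
    intro r hr1 hr2 hr3
    have hlog : Real.log (1 - r) ≤ 0 := Real.log_nonpos (by linarith) (by linarith)
    refine le_re_add_of_frontier hF hW hW0 hκ (mul_nonneg (by positivity) (by linarith)) hr3 hlow
      ?_ hr2 (by rw [hWre z₀ (by simpa using hz₀)]; exact hz₀κ)
    intro z hz hWz
    have := hgrowth z (by simpa [hz] using hr3) (by linarith) hWz
    rw [hz] at this
    linarith
  have hpos : 0 < 1 - (W z₀).re / κ := by
    rw [hWre z₀ (by simpa using hz₀), sub_pos, div_lt_one hκ]
    exact hz₀κ
  have htend : Tendsto (fun r : ℝ ↦ c / 2 * -Real.log (1 - r) * (1 - (W z₀).re / κ))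
      (𝓝[<] 1) atTop := by
    have h1 : Tendsto (fun r : ℝ ↦ 1 - r) (𝓝[<] 1) (𝓝[>] 0) := by
      refine tendsto_nhdsWithin_of_tendsto_nhds_of_eventually_within _ ?_ ?_
      · exact ((continuous_const.sub continuous_id).tendsto' (1 : ℝ) 0 (by simp)).mono_left
          nhdsWithin_le_nhds
      · filter_upwards [self_mem_nhdsWithin] with r hr using sub_pos.2 (mem_Iio.1 hr)
    have h2 := tendsto_neg_atBot_atTop.comp (Real.tendsto_log_nhdsGT_zero.comp h1)
    exact (h2.const_mul_atTop (by positivity)).atTop_mul_const hpos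
  have hev : ∀ᶠ r in 𝓝[<] (1 : ℝ),
      c / 2 * -Real.log (1 - r) * (1 - (W z₀).re / κ) ≤ (F z₀).re + A := by
    filter_upwards [self_mem_nhdsWithin, nhdsWithin_le_nhds (Ioi_mem_nhds hr₀1),
      nhdsWithin_le_nhds (Ioi_mem_nhds hz₀)] with r h1 h2 h3 using hineq r (le_of_lt h2) h3 h1
  obtain ⟨r, h1, h2⟩ := (hev.and (htend.eventually_gt_atTop _)).exists
  exact (h1.trans_lt h2).false

end RadialGrowth

/-- For every `u` in the class `K`, the set `E_+(u)` has Lebesgue measure zero. -/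
theorem stmt12 (u : ℂ → ℝ) (hu : ClassK u) : volume (Eplus u) = 0 := by
  obtain ⟨⟨F, hF, huF⟩, C, huC⟩ := hu
  have hFC : ∀ z ∈ Metric.ball (0 : ℂ) 1,
      (F z).re ≤ max C 1 * Real.log (Real.exp 1 / (1 - ‖z‖)) := by
    intro z hz
    rw [← huF z hz]
    refine (huC z hz).trans (mul_le_mul_of_nonneg_right (le_max_left _ _) (Real.log_nonneg ?_))
    rw [mem_ball_zero_iff] at hz
    rw [one_le_div (by linarith)]
    linarith [norm_nonneg z, Real.one_le_exp zero_le_one]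
  refine measure_mono_null (t := ⋃ n : ℕ, circleMap 0 1 ⁻¹'
    radialGrowthSet F (1 / (n + 1)) (1 - 1 / (n + 1))) ?_ (measure_iUnion_null fun n ↦ ?_)
  · rintro θ ⟨-, c, hc, hev⟩
    rw [eventually_nhdsWithin_iff, Metric.eventually_nhds_iff] at hev
    obtain ⟨ε, hε, h⟩ := hev
    obtain ⟨n, hn⟩ := exists_nat_one_div_lt (lt_min hc hε)
    have hn0 : (0 : ℝ) < 1 / (n + 1) := by positivity
    have hn1 : (1 : ℝ) / (n + 1) ≤ 1 := by
      rw [div_le_one (by positivity)]; linarith [n.cast_nonneg (α := ℝ)]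
    refine Set.mem_iUnion.2 ⟨n, by simp, fun r hr ↦ ?_⟩
    have hr1 : 0 < 1 - r := by linarith [hr.2]
    have hr0 : 0 ≤ r := by linarith [hr.1]
    have hd : dist r 1 < ε := by
      rw [dist_comm, Real.dist_eq, abs_of_pos hr1]
      linarith [hr.1, hn.trans_le (min_le_right c ε)]
    have hlog : Real.log (1 - r) ≤ 0 := Real.log_nonpos hr1.le (by linarith)
    have key := h hd hr.2
    have e : (r : ℂ) * Complex.exp (Complex.I * θ) = r * circleMap 0 1 θ := by
      simp [circleMap, mul_comm]
    have hmem : (r * circleMap 0 1 θ : ℂ) ∈ Metric.ball (0 : ℂ) 1 := by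
      simpa [abs_of_nonneg hr0] using hr.2
    rw [e, huF _ hmem, abs_of_nonpos hlog] at key
    have hpos : 0 < -Real.log (1 - r) := by
      refine lt_of_le_of_ne (by linarith) fun h0 ↦ ?_
      rw [← h0, div_zero] at key
      linarith
    rw [le_div_iff₀ hpos] at key
    have : (1 : ℝ) / (n + 1) ≤ c := (hn.trans_le (min_le_left c ε)).le
    exact (mul_le_mul_of_nonneg_right this hpos.le).trans key
  · have hn0 : (0 : ℝ) < 1 / (n + 1) := by positivity
    have hn1 : (1 : ℝ) / (n + 1) ≤ 1 := by
      rw [div_le_one (by positivity)]; linarith [n.cast_nonneg (α := ℝ)]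
    exact volume_preimage_radialGrowthSet hF (by positivity) hFC hn0 (by linarith) (by linarith)
end
end
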